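/- arXiv:1608.02817 — 3 statements merged into one kernel-verified Lean document; each statement's English description precedes it below -/
import Mathlib

section
/- For every non-negative integer n, the following identity holds in the field of rational functions Q(q, a, x): (∑_{k=0}^{n} (q^{-n};q)_k (a;q)_k (x;q)_k q^k / ((q;q)_k (x^2;q)_k))^2 = a^n · ∑_{k=0}^{n} (q^{-n};q)_k (x^2 q^n;q)_k (a;q)_k (x^2/a;q)_k (x;q)_k^2 q^k / ((q;q)_k (x^2;q)_k (x^2;q)_{2k}). -/
open Finset

/-- The q-Pochhammer symbol `(a;q)_n = ∏_{j=0}^{n-1} (1 - a q^j)`. -/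
noncomputable def qPoch {F : Type*} [Field F] (q a : F) (n : ℕ) : F :=
  ∏ j ∈ Finset.range n, (1 - a * q ^ j)

/-- The field of rational functions `ℚ(q, a, x)`. -/
abbrev F3 : Type := FractionRing (MvPolynomial (Fin 3) ℚ)

noncomputable def q : F3 := algebraMap (MvPolynomial (Fin 3) ℚ) F3 (MvPolynomial.X 0)
noncomputable def a : F3 := algebraMap (MvPolynomial (Fin 3) ℚ) F3 (MvPolynomial.X 1)
noncomputable def x : F3 := algebraMap (MvPolynomial (Fin 3) ℚ) F3 (MvPolynomial.X 2)


namespace QC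
variable {F : Type*} [Field F]

lemma poch_succ (q a : F) (k : ℕ) : qPoch q a (k+1) = qPoch q a k * (1 - a * q^k) := by
  simp [qPoch, Finset.prod_range_succ]

lemma poch_zero (q a : F) : qPoch q a 0 = 1 := by simp [qPoch]

/-- shift of the parameter -/
lemma poch_shift (q a : F) (k : ℕ) :
    qPoch q a k * (1 - a * q^k) = (1 - a) * qPoch q (a*q) k := by
  rw [← poch_succ]
  simp only [qPoch]
  rw [Finset.prod_range_succ']
  simp only [pow_zero, mul_one]
  rw [mul_comm]
  congr 1
  apply Finset.prod_congr rfl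
  intros; ring

lemma poch_vanish (q : F) (hq : q ≠ 0) (n k : ℕ) (h : n < k) : qPoch q ((q^n)⁻¹) k = 0 := by
  unfold qPoch
  apply Finset.prod_eq_zero (Finset.mem_range.2 h)
  field_simp
  simp

lemma poch_ne (q a : F) (h : ∀ j, 1 - a * q^j ≠ 0) (k : ℕ) : qPoch q a k ≠ 0 := by
  unfold qPoch
  exact Finset.prod_ne_zero_iff.2 fun j _ => h j

/-- coefficients of the left side -/
noncomputable def c (q x : F) (n k : ℕ) : F :=
  qPoch q ((q ^ n)⁻¹) k * qPoch q x k * q ^ k / (qPoch q q k * qPoch q (x ^ 2) k)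

/-- coefficients of the right side -/
noncomputable def s (q x : F) (n k : ℕ) : F :=
  qPoch q ((q ^ n)⁻¹) k * qPoch q (x ^ 2 * q ^ n) k * qPoch q x k ^ 2 * q ^ k /
          (qPoch q q k * qPoch q (x ^ 2) k * qPoch q (x ^ 2) (2 * k))

lemma pinv_down (q : F) (hq : q ≠ 0) (h1 : ∀ j : ℕ, 1 - q^(j+1) ≠ 0) (n k : ℕ) :
    qPoch q ((q^n)⁻¹) k = qPoch q ((q^(n+1))⁻¹) k * ((q * q^n - q^k) / (q * q^n - 1)) := by
  have h := poch_shift q ((q^(n+1))⁻¹) k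
  have e : (q^(n+1))⁻¹ * q = (q^n)⁻¹ := by rw [pow_succ]; field_simp
  rw [e] at h
  have h2 := h1 n
  have h3 : q * q^n - 1 ≠ 0 := by
    intro h; apply h2; rw [pow_succ]; linear_combination -h
  have e3 : (q^(n+1))⁻¹ * (q * q^n) = 1 := by rw [pow_succ]; field_simp
  rw [mul_div_assoc', eq_div_iff h3]
  linear_combination -(q*q^n) * h + (qPoch q ((q^n)⁻¹) k - q^k * qPoch q ((q^(n+1))⁻¹) k) * e3

lemma c_zero (q x : F) (n : ℕ) : c q x n 0 = 1 := by simp [c, poch_zero]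
lemma s_zero (q x : F) (n : ℕ) : s q x n 0 = 1 := by simp [s, poch_zero]

lemma c_down (q x : F) (hq : q ≠ 0) (h1 : ∀ j : ℕ, 1 - q^(j+1) ≠ 0) (n k : ℕ) :
    c q x n k = c q x (n+1) k * ((q * q^n - q^k) / (q * q^n - 1)) := by
  unfold c
  rw [pinv_down q hq h1]; ring

lemma s_down (q x : F) (hq : q ≠ 0) (h1 : ∀ j : ℕ, 1 - q^(j+1) ≠ 0)
    (h2 : ∀ j : ℕ, 1 - x^2 * q^j ≠ 0) (n k : ℕ) :
    s q x n k = s q x (n+1) k * ((q * q^n - q^k) / (q * q^n - 1) *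
      ((1 - x^2 * q^n) / (1 - x^2 * q^n * q^k))) := by
  unfold s
  have h := poch_shift q (x^2 * q^n) k
  have h3 := h2 (n+k)
  rw [pow_add, ← mul_assoc] at h3
  have h4 : qPoch q (x^2 * q^n) k = qPoch q (x^2 * q^(n+1)) k *
      ((1 - x^2 * q^n) / (1 - x^2 * q^n * q^k)) := by
    rw [pow_succ q n, ← mul_assoc (x^2), mul_div_assoc', eq_div_iff h3, h]; ring
  rw [pinv_down q hq h1, h4]; ring

lemma c_up (q x : F) (hq : q ≠ 0) (n k : ℕ) :
    c q x n (k+1) = c q x n k * ((q^n - q^k) * (1 - x * q^k) * q /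
      (q^n * (1 - q * q^k) * (1 - x^2 * q^k))) := by
  unfold c
  simp only [poch_succ]
  have : 1 - (q^n)⁻¹ * q^k = (q^n - q^k) / q^n := by field_simp
  rw [this, pow_succ, mul_div_assoc', div_mul_div_comm]
  field_simp

lemma s_up_aux (P u R Y Z X L K q A V B W C T U : F) (hL : L ≠ 0) :
    P * (u / R) * (Y * Z) * (X * L)^2 * (K * q) / (A * V * (B * W) * (C * (L * T) * U)) =
    P * Y * X^2 * K / (A * B * C) * (u * Z * L * q / (R * V * W * T * U)) := by
  have : (X * L)^2 / L = X^2 * L := by field_simp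
  calc _ = P * u * Y * Z * K * q * ((X * L)^2 / L) / (A * V * B * W * C * T * U * R) := by
        simp only [div_eq_mul_inv, mul_inv]; ring
    _ = _ := by rw [this]; simp only [div_eq_mul_inv, mul_inv]; ring

lemma s_up (q x : F) (hq : q ≠ 0) (n k : ℕ) 
    (h2 : ∀ j : ℕ, 1 - x^2 * q^j ≠ 0) :
    s q x n (k+1) = s q x n k * ((q^n - q^k) * (1 - x^2 * q^n * q^k) * (1 - x * q^k) * q /
      (q^n * (1 - q * q^k) * (1 - x^2 * q^k) * (1 + x * q^k) * (1 - x^2 * q * (q^k)^2))) := by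
  unfold s
  have e : 2 * (k+1) = 2 * k + 1 + 1 := by ring
  rw [e]
  simp only [poch_succ]
  have : 1 - (q^n)⁻¹ * q^k = (q^n - q^k) / q^n := by field_simp
  have hk := h2 (2*k)
  have e1 : 1 - x^2 * q^(2*k) = (1 - x*q^k) * (1 + x * q^k) := by ring
  have e2 : 1 - x^2 * q^(2*k+1) = 1 - x^2 * q * (q^k)^2 := by ring
  rw [e1] at hk
  have hk1 := left_ne_zero_of_mul hk
  rw [this, e1, e2, pow_succ q k]
  exact s_up_aux _ _ _ _ _ _ _ _ _ _ _ _ _ _ _ _ hk1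

lemma c_rat (q x Q K p : F) (hq : q ≠ 0) (hQ : Q ≠ 0) (hK : K ≠ 0)
  (h1 : q * Q - 1 ≠ 0) (h2 : q * (q * Q) - 1 ≠ 0) (h3 : 1 - q * K ≠ 0) (h4 : 1 - x^2 * K ≠ 0)
  (p1 p0 r2 r1 r0 : F) (e1 : p1 = p * ((q * (q * Q) - K) / (q * (q * Q) - 1)))
  (f2 : r2 = p * ((q*(q*Q) - K) * (1 - x * K) * q / (q*(q*Q) * (1 - q * K) * (1 - x^2 * K))))
  (f1 : r1 = r2 * ((q * (q * Q) - q*K) / (q * (q * Q) - 1)))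
  (f0 : r0 = r1 * ((q * Q - q*K) / (q * Q - 1)))
  (e0 : p0 = p1 * ((q * Q - K) / (q * Q - 1))) :
   (1 - x^2*(q*Q)) * r2 - x * (1 - x*(q*Q)) * r1 
    + (q*K)⁻¹ * ((1 - q*Q) * x * r0 - (1 - x*(q*Q)) * r1)
    - K⁻¹ * ((1 - q*Q) * x * p0 - (1 - x*(q*Q)) * p1) = 0 := by
  have h2' : q^2 * Q - 1 ≠ 0 := by
    intro h; apply h2; linear_combination h
  have E : q * (q * Q) = q^2 * Q := by ring
  rw [E] at *
  subst f0 f1 f2 e0 e1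
  field_simp
  ring

lemma s_poly (q x Q K : F) :
  K*q*((1 - x*(q*Q))*((1 - x^2*(q*Q))*x^2*(q*(q*Q)-1)*q^2*(q*(q*Q)-K)*(q*Q-K)*(1 - x^2*(q*Q)*K)
     - (1 - x^2*(q*(q*Q)))*(q*(q*(q*Q))-1)*(1 - x^2*(q*Q)*K)*(1 - x^2*(q*(q*Q))*K)*(1 - x^2*(q*(q*(q*Q)))*K))
    - (1 - x*(q*(q*Q)))*x*(x^2*(q*Q-1)*q^3*(q*(q*Q)-K)*(q*Q-K)*(Q-K)*(1-x^2*Q)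
     - (1 - x^2*(q*Q))*(q*(q*Q)-K)*q*(q*(q*Q)-1)*(1 - x^2*(q*Q)*K)*(1 - x^2*(q*(q*Q))*K)))
   + (1+x*(q*K))^2*(1-x*(q*K))*(1-x^2*q^3*Q^2)*(1 - x*(q*Q))*(1 - x*(q*(q*Q)))*q*(q*(q*Q)-K)*(1 - x^2*(q*Q)*K)
   - q*(1 - x*(q*Q))*(1 - x*(q*(q*Q)))*(q^2*Q)*((1 - q * K) * (1 - x^2 * K) * (1 + x * K) * (1 - x^2 * q * K^2))*(1-x^2*q^3*Q^2) = 0 := by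
  ring

lemma s_atoms (q x Q K w A1 A2 d0 d1 d2 e1 e2 e3 g1 g2 g3 u0 u1 u2 M L L' N Z : F)
  (hq : q ≠ 0) (hK : K ≠ 0)
  (hp : A2*g1 + x*A1*u2 = L*Z) (hr : A2*g2 + x*A1*(q*u1) = L'*Z)
  (key : K*q*(A1*(d1*x^2*e2*q^2*u2*u1*g1 - d2*e3*g1*g2*g3)
    - A2*x*(x^2*e1*q^3*u2*u1*u0*d0 - d1*u2*q*e2*g1*g2)) 
    + N^2*L'*Z*A1*A2*q*u2*g1 - q*A1*A2*(q^2*Q)*M*Z = 0)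
  (p2 p1 r3 r2 r1 r0 : F)
  (h2 : p2 = w*e2*e1*g1*d2*(q^2*Q)*M)
  (h1 : p1 = w*u2*e1*d1*d2*(q^2*Q)*M)
  (k3 : r3 = w*e3*e2*e1*g1*g2*g3*L)
  (k2 : r2 = w*u2*q*d2*e2*e1*g1*g2*L)
  (k1 : r1 = w*q^2*u2*u1*d1*d2*e1*g1*L)
  (k0 : r0 = w*q^3*u2*u1*u0*d0*d1*d2*L) :
  A1 * d1 * ((x * -e2)^2 * r1 - d2^2 * r3)
    + A2 * (x * -e2) * ((x* -e1)^2 * r0 - d1^2 * r2)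
    + (q*K)⁻¹ * N^2 * (A1 * A2 * (d1 * A2 * r2 - (x * -e2) * A1 * r1))
    - K⁻¹ * (A1 * A2 * (d1 * A2 * p2 - (x * -e2) * A1 * p1)) = 0 := by
  have E1 : d1 * A2 * r2 - (x * -e2) * A1 * r1 = w*u2*q*d1*d2*e2*e1*g1*L*(L'*Z) := by
    rw [← hr]; subst k2 k1; ring
  have E2 : d1 * A2 * p2 - (x * -e2) * A1 * p1 = w*e2*e1*d1*d2*(q^2*Q)*M*(L*Z) := by
    rw [← hp]; subst h2 h1; ring
  rw [E1, E2]
  have hKi : (q*K)⁻¹ = q⁻¹ * K⁻¹ := mul_inv _ _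
  have e : K⁻¹ = (q*K)⁻¹ * q := by field_simp
  rw [e]
  have hqK : q * K ≠ 0 := mul_ne_zero hq hK
  have hz : (q*K)⁻¹ * (K*q) = 1 := by rw [mul_comm K q]; exact inv_mul_cancel₀ hqK
  subst k3 k2 k1 k0
  clear hp hr E1 E2 hKi e h1 h2
  generalize (q*K)⁻¹ = I at *
  linear_combination (I*w*e1*e2*d1*d2*L) * key - (w*e1*e2*d1*d2*L*(A1*(d1*x^2*e2*q^2*u2*u1*g1 - d2*e3*g1*g2*g3)
    - A2*x*(x^2*e1*q^3*u2*u1*u0*d0 - d1*u2*q*e2*g1*g2))) * hz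

lemma s_conv (q Q p d0 d1 d2 e1 e2 e3 g1 g2 g3 u0 u1 u2 u3 M L : F)
  (hq : q ≠ 0) (hQ : Q ≠ 0) (he1 : e1 ≠ 0) (he2 : e2 ≠ 0) (he3 : e3 ≠ 0) (hg1 : g1 ≠ 0) (hg2 : g2 ≠ 0)
  (hg3 : g3 ≠ 0) (hM : M ≠ 0) (p2 p1 r3 r2 r1 r0 : F)
  (h2 : p2 = p * (u3 / e3 * (d2 / g2)))
  (h1 : p1 = p2 * (u2 / e2 * (d1 / g1)))
  (k3 : r3 = p * (u3 * g3 * L * q / (q^3*Q*M)))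
  (k2 : r2 = r3 * (q * u2 / e3 * (d2 / g3)))
  (k1 : r1 = r2 * (q * u1 / e2 * (d1 / g2)))
  (k0 : r0 = r1 * (q * u0 / e1 * (d0 / g1))) :
  ∃ w : F, p2 = w*e2*e1*g1*d2*(q^2*Q)*M ∧ p1 = w*u2*e1*d1*d2*(q^2*Q)*M ∧ r3 = w*e3*e2*e1*g1*g2*g3*L ∧
    r2 = w*u2*q*d2*e2*e1*g1*g2*L ∧ r1 = w*q^2*u2*u1*d1*d2*e1*g1*L ∧ r0 = w*q^3*u2*u1*u0*d0*d1*d2*L := by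
  refine ⟨p * u3 / (e3*e2*e1*g1*g2*(q^2*Q)*M), ?_, ?_, ?_, ?_, ?_, ?_⟩
  all_goals subst k0 k1 k2 k3 h1 h2
  all_goals field_simp

lemma s_rat (q x Q K p : F) (hq : q ≠ 0) (hQ : Q ≠ 0) (hK : K ≠ 0)
  (h1 : q * Q - 1 ≠ 0) (h2 : q * (q * Q) - 1 ≠ 0) (h2' : q * (q * (q * Q)) - 1 ≠ 0) 
  (h3 : 1 - q * K ≠ 0) (h4 : 1 - x^2 * K ≠ 0) (h5 : 1 + x * K ≠ 0) (h6 : 1 - x^2 * q * K^2 ≠ 0)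
  (g1 : 1 - x^2 * (q * Q) * K ≠ 0)
  (g2 : 1 - x^2 * (q * (q * Q)) * K ≠ 0)
  (g3 : 1 - x^2 * (q * (q * (q * Q))) * K ≠ 0)
  (p2 p1 r3 r2 r1 r0 : F) 
  (e2 : p2 = p * ((q * (q * (q * Q)) - K) / (q * (q * (q * Q)) - 1) * ((1 - x^2 * (q*(q*Q))) / (1 - x^2 * (q*(q*Q)) * K))))
  (e1 : p1 = p2 * ((q * (q * Q) - K) / (q * (q * Q) - 1) * ((1 - x^2 * (q*Q)) / (1 - x^2 * (q*Q) * K))))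
  (f3 : r3 = p * ((q*(q*(q*Q)) - K) * (1 - x^2 * (q*(q*(q*Q))) * K) * (1 - x * K) * q /
      (q*(q*(q*Q)) * (1 - q * K) * (1 - x^2 * K) * (1 + x * K) * (1 - x^2 * q * K^2))))
  (f2 : r2 = r3 * ((q * (q * (q * Q)) - q*K) / (q * (q * (q * Q)) - 1) * ((1 - x^2 * (q*(q*Q))) / (1 - x^2 * (q*(q*Q)) * (q*K)))))
  (f1 : r1 = r2 * ((q * (q * Q) - q*K) / (q * (q * Q) - 1) * ((1 - x^2 * (q*Q)) / (1 - x^2 * (q*Q) * (q*K)))))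
  (f0 : r0 = r1 * ((q * Q - q*K) / (q * Q - 1) * ((1 - x^2 * Q) / (1 - x^2 * Q * (q*K))))) :
   (1 - x*(q*Q)) * (1 - x^2*(q*Q)) * ((x * (1 - q*(q*Q)))^2 * r1 - (1 - x^2*(q*(q*Q)))^2 * r3)
    + (1 - x*(q*(q*Q))) * (x * (1 - q*(q*Q))) * ((x*(1 - q*Q))^2 * r0 - (1 - x^2*(q*Q))^2 * r2)
    + (q*K)⁻¹ * (1 + x*(q*K))^2 * ((1 - x*(q*Q)) * (1 - x*(q*(q*Q))) * ((1 - x^2*(q*Q)) * (1 - x*(q*(q*Q))) * r2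
       - (x * (1 - q*(q*Q))) * (1 - x*(q*Q)) * r1))
    - K⁻¹ * ((1 - x*(q*Q)) * (1 - x*(q*(q*Q))) * ((1 - x^2*(q*Q)) * (1 - x*(q*(q*Q))) * p2
       - (x * (1 - q*(q*Q))) * (1 - x*(q*Q)) * p1)) = 0 := by
  have a0 : 1 - x^2 * Q * (q*K) = 1 - x^2 * (q * Q) * K := by ring
  have a1 : 1 - x^2 * (q*Q) * (q*K) = 1 - x^2 * (q * (q * Q)) * K := by ring
  have a2 : 1 - x^2 * (q*(q*Q)) * (q*K) = 1 - x^2 * (q * (q * (q * Q))) * K := by ring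
  have b0 : q * Q - q * K = q * (Q - K) := by ring
  have b1 : q * (q * Q) - q * K = q * (q * Q - K) := by ring
  have b2 : q * (q * (q * Q)) - q * K = q * (q * (q * Q) - K) := by ring
  have m : q*(q*(q*Q)) * (1 - q * K) * (1 - x^2 * K) * (1 + x * K) * (1 - x^2 * q * K^2) =
    q^3*Q*((1 - q * K) * (1 - x^2 * K) * (1 + x * K) * (1 - x^2 * q * K^2)) := by ring
  rw [a0, b0] at f0
  rw [a1, b1] at f1
  rw [a2, b2] at f2
  rw [m] at f3
  have hM := mul_ne_zero (mul_ne_zero (mul_ne_zero h3 h4) h5) h6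
  obtain ⟨w, z2, z1, y3, y2, y1, y0⟩ := s_conv q Q p _ _ _ _ _ _ _ _ _ _ _ _ _ _ _ hq hQ h1 h2 h2' g1 g2 g3 hM
    _ _ _ _ _ _ e2 e1 f3 f2 f1 f0
  have c1 : 1 - q*(q*Q) = -(q*(q*Q) - 1) := by ring
  have c2 : 1 - q*Q = -(q*Q - 1) := by ring
  rw [c1, c2]
  exact s_atoms q x Q K w (1 - x*(q*Q)) (1 - x*(q*(q*Q))) (1 - x^2 * Q) (1 - x^2 * (q*Q)) (1 - x^2*(q*(q*Q)))
    (q*Q-1) (q*(q*Q)-1) (q*(q*(q*Q))-1) (1 - x^2 * (q * Q) * K) (1 - x^2 * (q * (q * Q)) * K)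
    (1 - x^2 * (q * (q * (q * Q))) * K) (Q-K) (q*Q-K) (q*(q*Q)-K)
    ((1 - q * K) * (1 - x^2 * K) * (1 + x * K) * (1 - x^2 * q * K^2)) (1 - x*K) (1 - x*(q*K)) (1+x*(q*K))
    (1-x^2*q^3*Q^2) hq hK (by ring) (by ring) (s_poly q x Q K) _ _ _ _ _ _ z2 z1 y3 y2 y1 y0


noncomputable def f (q x a : F) (n : ℕ) : F := ∑ k ∈ Finset.range (n+1), c q x n k * qPoch q a k

noncomputable def ph (q x a : F) (k : ℕ) : F := qPoch q a k * qPoch q (x^2/a) k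

noncomputable def S (q x a : F) (n : ℕ) : F := ∑ k ∈ Finset.range (n+1), s q x n k * ph q x a k

lemma c_van (q x : F) (hq : q ≠ 0) (n k : ℕ) (h : n < k) : c q x n k = 0 := by
  simp [c, poch_vanish q hq n k h]
lemma s_van (q x : F) (hq : q ≠ 0) (n k : ℕ) (h : n < k) : s q x n k = 0 := by
  simp [s, poch_vanish q hq n k h]

lemma f_ext (q x a : F) (hq : q ≠ 0) (n N : ℕ) (h : n ≤ N) :
    f q x a n = ∑ k ∈ Finset.range (N+1), c q x n k * qPoch q a k := by
  unfold f
  apply Finset.sum_subset (Finset.range_subset_range.2 (by omega))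
  intro k _ hk
  rw [c_van q x hq n k (by simpa using hk), zero_mul]

lemma S_ext (q x a : F) (hq : q ≠ 0) (n N : ℕ) (h : n ≤ N) :
    S q x a n = ∑ k ∈ Finset.range (N+1), s q x n k * ph q x a k := by
  unfold S
  apply Finset.sum_subset (Finset.range_subset_range.2 (by omega))
  intro k _ hk
  rw [s_van q x hq n k (by simpa using hk), zero_mul]

lemma f_tel (q x a : F) (hq : q ≠ 0) (h1 : ∀ j : ℕ, 1 - q^(j+1) ≠ 0)
    (h2 : ∀ j : ℕ, 1 - x^2 * q^j ≠ 0) (m N : ℕ) :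
    ∑ k ∈ Finset.range (N+1), ((1 - x^2*(q*q^m)) * c q x (m+2) k - x * (1 - x*(q*q^m)) * c q x (m+1) k
      + a * ((1 - q*q^m) * x * c q x m k - (1 - x*(q*q^m)) * c q x (m+1) k)) * qPoch q a k =
    - (q^N)⁻¹ * ((1 - q*q^m) * x * c q x m N - (1 - x*(q*q^m)) * c q x (m+1) N) * qPoch q a (N+1) := by
  induction N with
  | zero => simp [c_zero, poch_succ, poch_zero]; ring
  | succ N ih =>
    rw [Finset.sum_range_succ, ih, poch_succ q a (N+1)]
    have hN : q^N ≠ 0 := pow_ne_zero _ hq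
    have k1 := h1 m
    have k2 := h1 (m+1)
    have k3 := h1 N
    have H := c_rat q x (q^m) (q^N) (c q x (m+2) N) hq (pow_ne_zero _ hq) hN
      (by intro h; apply k1; linear_combination -h)
      (by intro h; apply k2; linear_combination -h)
      (by intro h; apply k3; linear_combination h) (h2 N)
      (c q x (m+1) N) (c q x m N) (c q x (m+2) (N+1)) (c q x (m+1) (N+1)) (c q x m (N+1))
      (by rw [c_down q x hq h1 (m+1) N]; simp only [pow_succ']) 
      (by rw [c_up q x hq (m+2) N]; simp only [pow_succ'])
      (by rw [c_down q x hq h1 (m+1) (N+1)]; simp only [pow_succ'])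
      (by rw [c_down q x hq h1 m (N+1)]; simp only [pow_succ'])
      (by rw [c_down q x hq h1 m N])
    have e : q^(N+1) = q * q^N := pow_succ' _ _
    have hi : (q * q^N)⁻¹ * (q*q^N) = 1 := inv_mul_cancel₀ (mul_ne_zero hq hN)
    rw [e]
    linear_combination (qPoch q a (N+1)) * H - a * ((1 - q*q^m) * x * c q x m (N+1) - (1 - x*(q*q^m)) * c q x (m+1) (N+1)) * qPoch q a (N+1) * hi

lemma f_rec (q x a : F) (hq : q ≠ 0) (h1 : ∀ j : ℕ, 1 - q^(j+1) ≠ 0)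
    (h2 : ∀ j : ℕ, 1 - x^2 * q^j ≠ 0) (m : ℕ) :
    (1 - x^2*(q*q^m)) * f q x a (m+2) - (a + x) * (1 - x*(q*q^m)) * f q x a (m+1)
      + (1 - q*q^m) * a * x * f q x a m = 0 := by
  have H := f_tel q x a hq h1 h2 m (m+2)
  rw [c_van q x hq m (m+2) (by omega), c_van q x hq (m+1) (m+2) (by omega)] at H
  rw [f_ext q x a hq m (m+2) (by omega), f_ext q x a hq (m+1) (m+2) (by omega),
    f_ext q x a hq (m+2) (m+2) (by omega), Finset.mul_sum, Finset.mul_sum, Finset.mul_sum,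
    ← Finset.sum_sub_distrib, ← Finset.sum_add_distrib]
  simp only [mul_zero, sub_zero, zero_mul] at H
  rw [← H]
  apply Finset.sum_congr rfl
  intros; ring

lemma S_tel (q x a : F) (ha : a ≠ 0) (hq : q ≠ 0) (h1 : ∀ j : ℕ, 1 - q^(j+1) ≠ 0)
    (h2 : ∀ j : ℕ, 1 - x^2 * q^j ≠ 0) (m N : ℕ) :
    ∑ k ∈ Finset.range (N+1), ((1 - x*(q*q^m)) * (1 - x^2*(q*q^m)) * ((x * (1 - q*(q*q^m)))^2 * s q x (m+1) k - (1 - x^2*(q*(q*q^m)))^2 * s q x (m+3) k)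
    + (1 - x*(q*(q*q^m))) * (x * (1 - q*(q*q^m))) * ((x*(1 - q*q^m))^2 * s q x m k - (1 - x^2*(q*q^m))^2 * s q x (m+2) k)
    + ((a+x)^2/a) * ((1 - x*(q*q^m)) * (1 - x*(q*(q*q^m))) * ((1 - x^2*(q*q^m)) * (1 - x*(q*(q*q^m))) * s q x (m+2) k
       - (x * (1 - q*(q*q^m))) * (1 - x*(q*q^m)) * s q x (m+1) k))) * ph q x a k =
    - (q^N)⁻¹ * ((1 - x*(q*q^m)) * (1 - x*(q*(q*q^m))) * ((1 - x^2*(q*q^m)) * (1 - x*(q*(q*q^m))) * s q x (m+2) N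
       - (x * (1 - q*(q*q^m))) * (1 - x*(q*q^m)) * s q x (m+1) N)) * ph q x a (N+1) := by
  have ht : (a+x)^2/a = a + x^2/a + 2*x := by field_simp; ring
  have haa : a * (x^2/a) = x^2 := by field_simp
  rw [ht]
  induction N with
  | zero =>
    simp [s_zero, ph, poch_succ, poch_zero]
    generalize x^2/a = y at *
    rw [← haa]
    generalize q^m = Q at *
    have : (1 - a) * (1 - y) = (1+x)^2 - (a + y + 2*x) := by linear_combination haa
    rw [this, haa]
    ring
  | succ N ih =>
    rw [Finset.sum_range_succ, ih]
    have hph : ph q x a (N+1+1) = ph q x a (N+1) * ((1 + x*(q*q^N))^2 - (q*q^N) * (a + x^2/a + 2*x)) := by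
      have e : q^(N+1) = q * q^N := pow_succ' _ _
      unfold ph
      rw [poch_succ q a (N+1), poch_succ q (x^2/a) (N+1), e]
      linear_combination (qPoch q a (N+1) * qPoch q (x^2/a) (N+1)) * (q*q^N)^2 * haa
    rw [hph]
    have hN : q^N ≠ 0 := pow_ne_zero _ hq
    have k1 := h1 m
    have k2 := h1 (m+1)
    have k2' := h1 (m+2)
    have k3 := h1 N
    have l1 := h2 (2*N)
    have l2 := h2 (2*N+1)
    have n1 := h2 (m+N+1)
    have n2 := h2 (m+N+2)
    have n3 := h2 (m+N+3)
    have H := s_rat q x (q^m) (q^N) (s q x (m+3) N) hq (pow_ne_zero _ hq) hN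
      (by intro h; apply k1; linear_combination -h)
      (by intro h; apply k2; linear_combination -h)
      (by intro h; apply k2'; linear_combination -h)
      (by intro h; apply k3; linear_combination h) (h2 N)
      (by intro h; apply l1; linear_combination (1 - x * q^N) * h)
      (by intro h; apply l2; linear_combination h)
      (by intro h; apply n1; linear_combination h)
      (by intro h; apply n2; linear_combination h)
      (by intro h; apply n3; linear_combination h)
      (s q x (m+2) N) (s q x (m+1) N) (s q x (m+3) (N+1)) (s q x (m+2) (N+1)) (s q x (m+1) (N+1)) (s q x m (N+1))
      (by rw [s_down q x hq h1 h2 (m+2) N]; simp only [pow_succ']) 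
      (by rw [s_down q x hq h1 h2 (m+1) N]; simp only [pow_succ']) 
      (by rw [s_up q x hq (m+3) N h2]; simp only [pow_succ'])
      (by rw [s_down q x hq h1 h2 (m+2) (N+1)]; simp only [pow_succ'])
      (by rw [s_down q x hq h1 h2 (m+1) (N+1)]; simp only [pow_succ'])
      (by rw [s_down q x hq h1 h2 m (N+1)]; simp only [pow_succ'])
    have e : q^(N+1) = q * q^N := pow_succ' _ _
    have hi : (q * q^N)⁻¹ * (q*q^N) = 1 := inv_mul_cancel₀ (mul_ne_zero hq hN)
    rw [e]
    clear ih hph k1 k2 k2' k3 l1 l2 n1 n2 n3 e ht haa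
    generalize (1 - x*(q*q^m)) * (1 - x*(q*(q*q^m))) * ((1 - x^2*(q*q^m)) * (1 - x*(q*(q*q^m))) * s q x (m+2) (N+1)
       - (x * (1 - q*(q*q^m))) * (1 - x*(q*q^m)) * s q x (m+1) (N+1)) = D1 at *
    generalize (1 - x*(q*q^m)) * (1 - x*(q*(q*q^m))) * ((1 - x^2*(q*q^m)) * (1 - x*(q*(q*q^m))) * s q x (m+2) N
       - (x * (1 - q*(q*q^m))) * (1 - x*(q*q^m)) * s q x (m+1) N) = D0 at *
    generalize (1 - x*(q*q^m)) * (1 - x^2*(q*q^m)) * ((x * (1 - q*(q*q^m)))^2 * s q x (m+1) (N+1) - (1 - x^2*(q*(q*q^m)))^2 * s q x (m+3) (N+1)) = E0 at *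
    generalize (1 - x*(q*(q*q^m))) * (x * (1 - q*(q*q^m))) * ((x*(1 - q*q^m))^2 * s q x m (N+1) - (1 - x^2*(q*q^m))^2 * s q x (m+2) (N+1)) = E1 at *
    generalize a + x^2/a + 2*x = t at *
    generalize (q*q^N)⁻¹ = I at *
    generalize (q^N)⁻¹ = J at *
    linear_combination (ph q x a (N+1)) * H - t * D1 * ph q x a (N+1) * hi

lemma S_rec (q x a : F) (ha : a ≠ 0) (hq : q ≠ 0) (h1 : ∀ j : ℕ, 1 - q^(j+1) ≠ 0)
    (h2 : ∀ j : ℕ, 1 - x^2 * q^j ≠ 0) (m : ℕ) :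
    (1 - x*(q*q^m)) * (1 - x^2*(q*q^m)) * ((x * (1 - q*(q*q^m)))^2 * S q x a (m+1) - (1 - x^2*(q*(q*q^m)))^2 * S q x a (m+3))
    + (1 - x*(q*(q*q^m))) * (x * (1 - q*(q*q^m))) * ((x*(1 - q*q^m))^2 * S q x a m - (1 - x^2*(q*q^m))^2 * S q x a (m+2))
    + ((a+x)^2/a) * ((1 - x*(q*q^m)) * (1 - x*(q*(q*q^m))) * ((1 - x^2*(q*q^m)) * (1 - x*(q*(q*q^m))) * S q x a (m+2)
       - (x * (1 - q*(q*q^m))) * (1 - x*(q*q^m)) * S q x a (m+1))) = 0 := by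
  have H := S_tel q x a ha hq h1 h2 m (m+3)
  rw [s_van q x hq (m+2) (m+3) (by omega), s_van q x hq (m+1) (m+3) (by omega)] at H
  rw [S_ext q x a hq m (m+3) (by omega), S_ext q x a hq (m+1) (m+3) (by omega),
    S_ext q x a hq (m+2) (m+3) (by omega), S_ext q x a hq (m+3) (m+3) (by omega)]
  simp only [mul_zero, sub_zero, zero_mul] at H
  rw [← H]
  simp only [Finset.mul_sum, ← Finset.sum_sub_distrib, ← Finset.sum_add_distrib]
  apply Finset.sum_congr rfl
  intros
  generalize (a+x)^2/a = t
  ring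

lemma step_atoms (a x z A1 A2 d1 d2 b1 b2 F0 F1 F2 F3 S0 S1 S2 S3 : F) (ha : a ≠ 0) (hA : A1 ≠ 0)
  (hd1 : d1 ≠ 0) (hd2 : d2 ≠ 0)
  (r1 : d1 * F2 - (a+x)*A1*F1 + a*b1*F0 = 0) (r2 : d2 * F3 - (a+x)*A2*F2 + a*b2*F1 = 0)
  (s0 : z * S0 = F0^2) (s1 : z * a * S1 = F1^2) (s2 : z * a^2 * S2 = F2^2)
  (H : A1 * d1 * (b2^2 * S1 - d2^2 * S3) + A2 * b2 * (b1^2 * S0 - d1^2 * S2)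
    + ((a+x)^2/a) * (A1 * A2 * (d1 * A2 * S2 - b2 * A1 * S1)) = 0) :
  z * a^3 * S3 = F3^2 := by
  have ht : (a+x)^2/a*a = (a+x)^2 := by field_simp
  generalize (a+x)^2/a = t at *
  have h : A1 * d1 * d2^2 ≠ 0 := mul_ne_zero (mul_ne_zero hA hd1) (pow_ne_zero _ hd2)
  apply mul_left_cancel₀ h
  have H' : A1 * d1 * (b2^2 * a^2 * F1^2 - d2^2 * (z*a^3*S3)) + A2 * b2 * (b1^2 * a^3*F0^2 - d1^2 * a*F2^2)
    + (a+x)^2 * (A1 * A2 * (d1 * A2 * F2^2 - b2 * A1 * a * F1^2)) = 0 := by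
    rw [← s0, ← s1, ← s2, ← ht]
    linear_combination z * a^3 * H
  clear H ht s0 s1 s2
  have e2 : A1 * d1 * (d2*F3)^2 = A1 * d1 * ((a+x)*A2*F2 - a*b2*F1)^2 := by
    have : d2 * F3 = (a+x)*A2*F2 - a*b2*F1 := by linear_combination r2
    rw [this]
  linear_combination -H' - e2 - (A2*b2*a) * (d1*F2 - (a+x)*A1*F1 - a*b1*F0) * r1

lemma f0 (q x a : F) : f q x a 0 = 1 := by simp [f, c_zero, poch_zero]
lemma S0 (q x a : F) : S q x a 0 = 1 := by simp [S, s_zero, ph, poch_zero]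

lemma f1 (q x a : F) (hq : q ≠ 0) (h1 : 1 - q ≠ 0) (h2 : 1 - x^2 ≠ 0) : (1 + x) * f q x a 1 = a + x := by
  have e : 1 - x^2 = (1-x)*(1+x) := by ring
  have h3 : 1 - x ≠ 0 := by intro h; apply h2; rw [e, h, zero_mul]
  have h4 : 1 + x ≠ 0 := by intro h; apply h2; rw [e, h, mul_zero]
  simp only [f, Finset.sum_range_succ, Finset.sum_range_zero, c_up q x hq 1 0, c_zero, poch_succ, poch_zero, pow_zero, mul_one, pow_one, e]
  field_simp
  ring

lemma s1 (q x a : F) (ha : a ≠ 0) (hq : q ≠ 0) (h1 : ∀ j : ℕ, 1 - q^(j+1) ≠ 0)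
    (h2 : ∀ j : ℕ, 1 - x^2 * q^j ≠ 0) : a * (1+x)^2 * S q x a 1 = (a+x)^2 := by
  have e : 1 - x^2 = (1-x)*(1+x) := by ring
  have h20 := h2 0
  have h21 := h2 1
  have h10 := h1 0
  simp only [pow_zero, zero_add, pow_one, mul_one] at h20 h21 h10
  have h3 : 1 - x ≠ 0 := by intro h; apply h20; rw [e, h, zero_mul]
  have h4 : 1 + x ≠ 0 := by intro h; apply h20; rw [e, h, mul_zero]
  have h21' : 1 - q*x^2 ≠ 0 := by rw [mul_comm]; exact h21
  have k : s q x 1 1 = -1/(1+x)^2 := by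
    rw [s_up q x hq 1 0 h2, s_zero]
    simp only [pow_zero, mul_one, pow_one, one_pow, e, one_mul]
    field_simp
    ring
  simp only [S, Finset.sum_range_succ, Finset.sum_range_zero, s_zero, k, ph, poch_succ, poch_zero, pow_zero, mul_one, one_mul]
  field_simp
  ring

lemma s2 (q x a : F) (ha : a ≠ 0) (hq : q ≠ 0) (h1 : ∀ j : ℕ, 1 - q^(j+1) ≠ 0)
    (h2 : ∀ j : ℕ, 1 - x^2 * q^j ≠ 0) : 
    a^2 * (1+x)^2 * (1-x^2*q)^2 * S q x a 2 = ((a+x)^2*(1-x*q) - (1-q)*a*x*(1+x))^2 := by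
  have e : 1 - x^2 = (1-x)*(1+x) := by ring
  have h20 := h2 0
  have h21 := h2 1
  have h22 := h2 2
  have h23 := h2 3
  have h10 := h1 0
  have h11 := h1 1
  simp only [pow_zero, zero_add, pow_one, mul_one] at h20 h21 h10
  have h3 : 1 - x ≠ 0 := by intro h; apply h20; rw [e, h, zero_mul]
  have h4 : 1 + x ≠ 0 := by intro h; apply h20; rw [e, h, mul_zero]
  have h5 : 1 + x*q ≠ 0 := by intro h; apply h22; linear_combination (1-x*q)*h
  have h6 : 1 + q ≠ 0 := by intro h; apply h11; linear_combination (1-q)*h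
  have h21' : 1 - q*x^2 ≠ 0 := by rw [mul_comm]; exact h21
  have h5' : 1 + q*x ≠ 0 := by rw [mul_comm]; exact h5
  have h23' : 1 - q^3*x^2 ≠ 0 := by rw [mul_comm]; exact h23
  have k : s q x 2 1 = -(1+q)*(1-x^2*q^2)/(q*(1+x)^2*(1-x^2*q)) := by
    rw [s_up q x hq 2 0 h2, s_zero]
    simp only [pow_zero, mul_one, one_pow, e, one_mul]
    field_simp
    ring
  have r : (q^2 - q) * (1 - x^2*q^2*q) * (1 - x*q)*q/(q^2*(1-q*q)*(1-x^2*q)*(1+x*q)*(1-x^2*q*q^2)) =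
      -(1-x*q)/((1+q)*(1-x^2*q)*(1+x*q)) := by
    have g1 : 1 - q*q = (1-q)*(1+q) := by ring
    have g2 : 1 - x^2*q*q^2 = 1 - x^2*q^3 := by ring
    have g3 : 1 - x^2*q^2*q = 1 - x^2*q^3 := by ring
    rw [g1, g2, g3]
    field_simp
    ring
  have k2 : s q x 2 2 = (1-x*q)^2/(q*(1+x)^2*(1-x^2*q)^2) := by
    rw [s_up q x hq 2 1 h2, k]
    simp only [pow_one]
    rw [r]
    have g : 1 - x^2*q^2 = (1-x*q)*(1+x*q) := by ring
    rw [g]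
    field_simp
  simp only [S, Finset.sum_range_succ, Finset.sum_range_zero, s_zero, k, k2, ph, poch_succ, poch_zero, pow_zero, mul_one, one_mul, pow_one]
  field_simp
  ring

lemma main (q x a : F) (ha : a ≠ 0) (hq : q ≠ 0) (h1 : ∀ j : ℕ, 1 - q^(j+1) ≠ 0)
    (h2 : ∀ j : ℕ, 1 - x^2 * q^j ≠ 0) (n : ℕ) : 
    a^n * S q x a n = f q x a n ^2 ∧ a^(n+1) * S q x a (n+1) = f q x a (n+1) ^2 ∧
    a^(n+2) * S q x a (n+2) = f q x a (n+2) ^2 := by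
  induction n with
  | zero =>
    have h20 := h2 0
    have h21 := h2 1
    have h10 := h1 0
    simp only [pow_zero, zero_add, pow_one, mul_one] at h20 h21 h10
    have h4 : 1 + x ≠ 0 := by intro h; apply h20; linear_combination (1-x)*h
    have F1 := f1 q x a hq h10 h20
    have F2 := f_rec q x a hq h1 h2 0
    have s1 := s1 q x a ha hq h1 h2
    have s2 := s2 q x a ha hq h1 h2
    simp only [pow_zero, zero_add, mul_one, f0] at F2 ⊢
    refine ⟨by simp [S0], ?_, ?_⟩
    · apply mul_left_cancel₀ (pow_ne_zero 2 h4)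
      rw [← F1] at s1
      linear_combination s1
    · apply mul_left_cancel₀ (pow_ne_zero 2 (mul_ne_zero h4 h21))
      have : (1+x)*(1-x^2*q) * f q x a 2 = (a+x)^2*(1-x*q) - (1-q)*a*x*(1+x) := by
        linear_combination (1+x) * F2 + (a+x)*(1-x*q)*F1
      rw [← this] at s2
      linear_combination s2
  | succ m ih =>
    obtain ⟨i0, i1, i2⟩ := ih
    refine ⟨i1, i2, ?_⟩
    have l := h2 (2*(m+1))
    have d1 := h2 (m+1)
    have d2 := h2 (m+2)
    have r1 := f_rec q x a hq h1 h2 m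
    have r2 := f_rec q x a hq h1 h2 (m+1)
    have e : q^(m+1) = q * q^m := pow_succ' _ _
    have e2 : q^(m+2) = q * (q * q^m) := by ring
    rw [e] at r2 d1
    rw [e2] at d2
    have := step_atoms a x (a^m) (1 - x*(q*q^m)) (1 - x*(q*(q*q^m))) (1 - x^2*(q*q^m)) (1 - x^2*(q*(q*q^m)))
      (x*(1-q*q^m)) (x*(1 - q*(q*q^m))) (f q x a m) (f q x a (m+1)) (f q x a (m+2)) (f q x a (m+3)) 
      (S q x a m) (S q x a (m+1)) (S q x a (m+2)) (S q x a (m+3)) ha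
      (by intro h; apply l; linear_combination (1 + x*(q*q^m))*h) d1 d2 
      (by linear_combination r1) (by linear_combination r2) i0 (by rw [← i1]; ring) (by rw [← i2]; ring)
      (S_rec q x a ha hq h1 h2 m)
    rw [show m+1+2 = m+3 from rfl, ← this]
    ring

end QC

lemma q_ne_aux (j : ℕ) : 1 - q^(j+1) ≠ 0 := by
  have : 1 - q^(j+1) = algebraMap (MvPolynomial (Fin 3) ℚ) F3 (1 - MvPolynomial.X 0^(j+1)) := by
    simp [q]
  rw [this]
  intro h
  rw [map_eq_zero_iff _ (IsFractionRing.injective (MvPolynomial (Fin 3) ℚ) F3)] at h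
  have h' := congrArg (MvPolynomial.eval (fun _ => (2:ℚ))) h
  simp only [map_sub, map_one, map_pow, MvPolynomial.eval_X, map_zero] at h'
  have : (1:ℚ) < 2^(j+1) := one_lt_pow₀ (by norm_num) (by omega)
  linarith

lemma x_ne_aux (j : ℕ) : 1 - x^2 * q^j ≠ 0 := by
  have : 1 - x^2 * q^j = algebraMap (MvPolynomial (Fin 3) ℚ) F3 (1 - MvPolynomial.X 2^2 * MvPolynomial.X 0^j) := by
    simp [q, x]
  rw [this]
  intro h
  rw [map_eq_zero_iff _ (IsFractionRing.injective (MvPolynomial (Fin 3) ℚ) F3)] at h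
  have h' := congrArg (MvPolynomial.eval (fun _ => (2:ℚ))) h
  simp only [map_sub, map_one, map_mul, map_pow, MvPolynomial.eval_X, map_zero] at h'
  have : (1:ℚ) ≤ 2^j := one_le_pow₀ (by norm_num)
  linarith

lemma q_ne0 : q ≠ 0 := by
  unfold q
  rw [Ne, map_eq_zero_iff _ (IsFractionRing.injective (MvPolynomial (Fin 3) ℚ) F3)]
  exact MvPolynomial.X_ne_zero _

lemma a_ne0 : a ≠ 0 := by
  unfold a
  rw [Ne, map_eq_zero_iff _ (IsFractionRing.injective (MvPolynomial (Fin 3) ℚ) F3)]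
  exact MvPolynomial.X_ne_zero _

theorem q_Clausen_square (n : ℕ) :
    (∑ k ∈ Finset.range (n + 1),
        qPoch q ((q ^ n)⁻¹) k * qPoch q a k * qPoch q x k * q ^ k /
          (qPoch q q k * qPoch q (x ^ 2) k)) ^ 2 =
    a ^ n * ∑ k ∈ Finset.range (n + 1),
        qPoch q ((q ^ n)⁻¹) k * qPoch q (x ^ 2 * q ^ n) k * qPoch q a k *
          qPoch q (x ^ 2 / a) k * qPoch q x k ^ 2 * q ^ k /
          (qPoch q q k * qPoch q (x ^ 2) k * qPoch q (x ^ 2) (2 * k)) := by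
  have H := (QC.main q x a a_ne0 q_ne0 q_ne_aux x_ne_aux n).1
  unfold QC.S QC.f QC.s QC.c QC.ph at H
  convert H.symm using 2
  · apply Finset.sum_congr rfl
    intros; ring
  · apply Finset.sum_congr rfl
    intros; ring
end

section
/- For every non-negative integer n, the following identity holds in the field of rational functions Q(q, c, x): (∑_{k=0}^{n} (q^{-n};q)_k (x;q^2)_k q^k / ((q;q)_k (c;q)_k)) · (∑_{k=0}^{n} (q^{-n};q)_k (x;q^2)_k c^k q^{nk - k(k-1)/2} / ((q;q)_k (c;q)_k x^k)) = ∑_{k=0}^{n} (q^{-n};q)_k (c q^n;q)_k (x;q^2)_k (c^2/x;q^2)_k q^k / ((q;q)_k (c;q)_k (c;q)_{2k}). -/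
open Finset

noncomputable def c : F3 := algebraMap (MvPolynomial (Fin 3) ℚ) F3 (MvPolynomial.X 1)
lemma co_tel {F : Type*} [Field F] (φ e h : ℕ → F) (h0 : e 0 = 0) (hs : ∀ k, e (k+1) = - h k)
    (N : ℕ) : ∑ k ∈ Finset.range (N+1), (e k * φ k + h k * φ (k+1)) = h N * φ (N+1) := by
  induction N with
  | zero => simp [h0]
  | succ N ih => rw [Finset.sum_range_succ, ih, hs]; ring

lemma qp_zero {F : Type*} [Field F] (q a : F) : qPoch q a 0 = 1 := by simp [qPoch]

lemma qp_succ {F : Type*} [Field F] (q a : F) (k : ℕ) :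
    qPoch q a (k+1) = qPoch q a k * (1 - a * q ^ k) := by simp [qPoch, Finset.prod_range_succ]

lemma qp_shift {F : Type*} [Field F] (q a : F) (k : ℕ) :
    (1 - a) * qPoch q (a * q) k = qPoch q a k * (1 - a * q ^ k) := by
  induction k with
  | zero => simp [qp_zero]
  | succ k ih => rw [qp_succ, qp_succ, ← mul_assoc, ih]; ring

lemma qp_van {F : Type*} [Field F] (q : F) (hq : q ≠ 0) (n k : ℕ) (h : n < k) :
    qPoch q ((q^n)⁻¹) k = 0 := by
  unfold qPoch
  apply Finset.prod_eq_zero (Finset.mem_range.2 h)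
  rw [inv_mul_cancel₀ (pow_ne_zero _ hq), sub_self]

lemma qp_ne {F : Type*} [Field F] (q c : F) (hc : ∀ j : ℕ, 1 - c * q^j ≠ 0) (k : ℕ) :
    qPoch q c k ≠ 0 := Finset.prod_ne_zero_iff.2 fun j _ => hc j

section
variable {F : Type*} [Field F]

lemma qp_d1 (q : F) (hq : q ≠ 0) (hq1 : ∀ j : ℕ, 1 - q * q^j ≠ 0) (m k : ℕ) :
    qPoch q ((q^(m+1))⁻¹) k = qPoch q ((q^(m+2))⁻¹) k * (q^2*q^m - q^k) / (q^2*q^m-1) := by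
  have h := qp_shift q ((q^(m+2))⁻¹) k
  have e : (q^(m+2))⁻¹ * q = (q^(m+1))⁻¹ := by
    have := pow_ne_zero m hq
    field_simp; try ring
  rw [e] at h
  have h1 := hq1 (m+1)
  have h2 : q^2*q^m-1 ≠ 0 := by
    intro h; apply h1; linear_combination -h
  rw [eq_div_iff h2]
  have hm := pow_ne_zero m hq
  have : (q^(m+2))⁻¹ = (q^2*q^m)⁻¹ := by rw [pow_add, mul_comm]
  generalize qPoch q ((q^(m+2))⁻¹) k = Y at *
  rw [this] at h
  generalize qPoch q ((q^(m+1))⁻¹) k = Y2 at *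
  field_simp at h
  linear_combination h

lemma qp_d2 (q : F) (hq : q ≠ 0) (hq1 : ∀ j : ℕ, 1 - q * q^j ≠ 0) (m k : ℕ) :
    qPoch q ((q^m)⁻¹) k = qPoch q ((q^(m+2))⁻¹) k * (q^2*q^m - q^k) / (q^2*q^m-1)
      * (q*q^m - q^k) / (q*q^m-1) := by
  have h := qp_shift q ((q^(m+1))⁻¹) k
  have e : (q^(m+1))⁻¹ * q = (q^m)⁻¹ := by
    have := pow_ne_zero m hq
    field_simp; try ring
  rw [e] at h
  have h1 := hq1 m
  have h2 : q*q^m-1 ≠ 0 := by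
    intro h; apply h1; linear_combination -h
  rw [← qp_d1 q hq hq1, eq_div_iff h2]
  have hm := pow_ne_zero m hq
  have : (q^(m+1))⁻¹ = (q*q^m)⁻¹ := by rw [pow_add, mul_comm, pow_one]
  generalize qPoch q ((q^(m+1))⁻¹) k = Y at *
  rw [this] at h
  generalize qPoch q ((q^m)⁻¹) k = Y2 at *
  field_simp at h
  linear_combination h

lemma qp_c1 (q c : F) (hc : ∀ j : ℕ, 1 - c * q^j ≠ 0) (m k : ℕ) :
    qPoch q (c*q^(m+1)) k = qPoch q (c*q^m) k * (1 - c*q^m*q^k) / (1-c*q^m) := by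
  have h := qp_shift q (c*q^m) k
  rw [eq_div_iff (hc m), ← h, pow_succ]; ring_nf

lemma qp_c2 (q c : F) (hc : ∀ j : ℕ, 1 - c * q^j ≠ 0) (m k : ℕ) :
    qPoch q (c*q^(m+2)) k = qPoch q (c*q^m) k * (1 - c*q^m*q^k) / (1-c*q^m)
      * (1 - c*q*q^m*q^k) / (1-c*q*q^m) := by
  have h := qp_c1 q c hc (m+1) k
  rw [h, qp_c1 q c hc]
  ring_nf

/-- coefficients -/
noncomputable def aco (q c : F) (n k : ℕ) : F :=
  qPoch q ((q^n)⁻¹) k * q^k / (qPoch q q k * qPoch q c k)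

noncomputable def bco (q c : F) (n k : ℕ) : F :=
  qPoch q ((q^n)⁻¹) k * c^k * q^(n*k) * (q ^ (k * (k - 1) / 2))⁻¹ / (qPoch q q k * qPoch q c k)

noncomputable def cco (q c : F) (n k : ℕ) : F :=
  qPoch q ((q^n)⁻¹) k * qPoch q (c*q^n) k * q^k / (qPoch q q k * qPoch q c k * qPoch q c (2*k))

noncomputable def rhoR (q c Q K : F) : F :=
  ((-c*Q - q/Q)*(1-c*K^2) + (c+q) - c*(q-1)*K - c*(c+q)*K^2/q - c^2*(q-1)*K^3/q)/q

noncomputable def rhoS (q c Q K : F) : F :=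
  ((-c*Q/K - q/(Q*K))*(1-c*K^2) - q*(q-1)/K^2 + q*(c+q)/K - c*(q-1) - c*(c+q)*K)/q

/-- index `m` stands for `n = m+1`. -/
noncomputable def rco (q c : F) (m k : ℕ) : F :=
  qPoch q ((q^(m+1))⁻¹) k * qPoch q (c*q^m) k * q^k /
    (qPoch q q k * qPoch q c k * qPoch q c (2*k)) / ((1-1/(q*q^m))*(1-c*q^m))
    * rhoR q c (q*q^m) (q^k)

noncomputable def sco (q c : F) (m k : ℕ) : F :=
  qPoch q ((q^(m+1))⁻¹) k * qPoch q (c*q^m) k * q^k /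
    (qPoch q q k * qPoch q c k * qPoch q c (2*k)) / ((1-1/(q*q^m))*(1-c*q^m))
    * rhoS q c (q*q^m) (q^k)

lemma a_rec (q c x : F) (hq : q ≠ 0) (hq1 : ∀ j : ℕ, 1 - q * q^j ≠ 0)
    (hc : ∀ j : ℕ, 1 - c * q^j ≠ 0) (ψ : ℕ → F)
    (hψ : ∀ k, ψ (k+1) = (1 - x * (q^k)^2) * ψ k) (m N : ℕ) (hN : m + 1 < N) :
    (1-c*q*q^m) * ∑ k ∈ Finset.range (N+1), aco q c (m+2) k * ψ k =
     q*q^m*(x-c) * ∑ k ∈ Finset.range (N+1), aco q c (m+1) k * ψ k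
     + (1-q*q^m)*x * ∑ k ∈ Finset.range (N+1), aco q c m k * ψ k := by
  have T := co_tel ψ
    (fun k => (1-c*q*q^m) * aco q c (m+2) k - q*q^m*(1/(q^k)^2-c)*aco q c (m+1) k
      - (1-q*q^m)/(q^k)^2*aco q c m k)
    (fun k => (q*q^m*aco q c (m+1) k + (1-q*q^m)*aco q c m k)/(q^k)^2)
    (by simp [aco, qp_zero]; ring)
    (by
      intro k
      simp only [aco]
      rw [qp_d1 q hq hq1 m k, qp_d1 q hq hq1 m (k+1), qp_d2 q hq hq1 m k, qp_d2 q hq hq1 m (k+1),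
        qp_succ, qp_succ, qp_succ]
      have n1 := qp_ne q q hq1 k
      have n2 := qp_ne q c hc k
      have n3 := hq1 k
      have n4 := hc k
      have n5 : q^2*q^m-1 ≠ 0 := by
        intro h; apply hq1 (m+1); linear_combination -h
      have n6 : q*q^m-1 ≠ 0 := by
        intro h; apply hq1 m; linear_combination -h
      have n7 := pow_ne_zero m hq
      have n8 := pow_ne_zero k hq
      have e1 : q^(m+2) = q^2*q^m := by ring
      have e2 : q^(k+1) = q*q^k := by ring
      generalize qPoch q ((q^(m+2))⁻¹) k = Y at *
      rw [e1, e2]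
      generalize qPoch q q k = G1 at *
      generalize qPoch q c k = G2 at *
      generalize q^m = M at *
      generalize q^k = K at *
      field_simp
      ring) N
  have v1 : aco q c (m+1) N = 0 := by simp [aco, qp_van q hq (m+1) N hN]
  have v2 : aco q c m N = 0 := by simp [aco, qp_van q hq m N (by omega)]
  simp only [v1, v2] at T
  rw [Finset.mul_sum, Finset.mul_sum, Finset.mul_sum, ← Finset.sum_add_distrib, ← sub_eq_zero,
    ← Finset.sum_sub_distrib]
  rw [mul_zero, mul_zero, add_zero, zero_div, zero_mul] at T
  rw [← T]
  refine Finset.sum_congr rfl fun k _ => ?_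
  rw [hψ]
  have n8 := pow_ne_zero k hq
  field_simp
  ring

lemma b_rec (q c x : F) (hq : q ≠ 0) (hx : x ≠ 0) (hq1 : ∀ j : ℕ, 1 - q * q^j ≠ 0)
    (hc : ∀ j : ℕ, 1 - c * q^j ≠ 0) (ψ : ℕ → F)
    (hψ : ∀ k, ψ (k+1) = (1/x - (q^k)^2) * ψ k) (m N : ℕ) (hN : m + 1 < N) :
    (1-c*q*q^m) * ∑ k ∈ Finset.range (N+1), bco q c (m+2) k * ψ k =
     (1-c/x) * ∑ k ∈ Finset.range (N+1), bco q c (m+1) k * ψ k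
     + c*(1-q*q^m)/x * ∑ k ∈ Finset.range (N+1), bco q c m k * ψ k := by
  have T := co_tel ψ
    (fun k => (1-c*q*q^m) * bco q c (m+2) k - (1-c*(q^k)^2)*bco q c (m+1) k
      - c*(1-q*q^m)*(q^k)^2*bco q c m k)
    (fun k => c*bco q c (m+1) k - c*(1-q*q^m)*bco q c m k)
    (by simp [bco, qp_zero]; ring)
    (by
      intro k
      simp only [bco]
      rw [qp_d1 q hq hq1 m k, qp_d1 q hq hq1 m (k+1), qp_d2 q hq hq1 m k, qp_d2 q hq hq1 m (k+1),
        qp_succ, qp_succ, qp_succ]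
      have n1 := qp_ne q q hq1 k
      have n2 := qp_ne q c hc k
      have n3 := hq1 k
      have n4 := hc k
      have n5 : q^2*q^m-1 ≠ 0 := by
        intro h; apply hq1 (m+1); linear_combination -h
      have n6 : q*q^m-1 ≠ 0 := by
        intro h; apply hq1 m; linear_combination -h
      have n7 := pow_ne_zero m hq
      have n8 := pow_ne_zero k hq
      have n9 := pow_ne_zero (m*k) hq
      have e1 : q^(m+2) = q^2*q^m := by ring
      have e2 : q^(k+1) = q*q^k := by ring
      have e3 : q^((m+2)*k) = q^(m*k)*(q^k)^2 := by ring
      have e4 : q^((m+1)*k) = q^(m*k)*(q^k) := by ring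
      have e5 : q^((m+2)*(k+1)) = q^(m*k)*q^m*(q*q^k)^2 := by ring
      have e6 : q^((m+1)*(k+1)) = q^(m*k)*q^m*(q*q^k) := by ring
      have e7 : q^(m*(k+1)) = q^(m*k)*q^m := by ring
      have e8 : q^((k+1)*(k+1-1)/2) = q^(k*(k-1)/2) * q^k := by
        rw [← pow_add]; congr 1
        rw [← Finset.sum_range_id, ← Finset.sum_range_id, Finset.sum_range_succ]
      have n10 := pow_ne_zero (k*(k-1)/2) hq
      rw [e4, e5, e6, e7, e8]
      generalize qPoch q ((q^(m+2))⁻¹) k = Y at *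
      rw [e1, e2, pow_succ c k]
      generalize qPoch q q k = G1 at *
      generalize qPoch q c k = G2 at *
      generalize q^(k*(k-1)/2) = H at *
      generalize q^(m*k) = H2 at *
      generalize q^m = M at *
      generalize q^k = K at *
      field_simp
      ring) N
  have v1 : bco q c (m+1) N = 0 := by simp [bco, qp_van q hq (m+1) N hN]
  have v2 : bco q c m N = 0 := by simp [bco, qp_van q hq m N (by omega)]
  simp only [v1, v2] at T
  rw [Finset.mul_sum, Finset.mul_sum, Finset.mul_sum, ← Finset.sum_add_distrib, ← sub_eq_zero,
    ← Finset.sum_sub_distrib]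
  rw [mul_zero, mul_zero, sub_zero, zero_mul] at T
  rw [← T]
  refine Finset.sum_congr rfl fun k _ => ?_
  rw [hψ]
  field_simp
  ring

set_option maxHeartbeats 2000000 in
lemma c_rec1 (q c X : F) (hq : q ≠ 0) (hq1 : ∀ j : ℕ, 1 - q * q^j ≠ 0)
    (hc : ∀ j : ℕ, 1 - c * q^j ≠ 0) (φ : ℕ → F)
    (hφ : ∀ k, φ (k+1) = ((1 - c * (q^k)^2)^2 - (q^k)^2*X) * φ k) (m N : ℕ) (hN : m + 1 < N) :
    (1-c*q*q^m)^2 * ∑ k ∈ Finset.range (N+1), cco q c (m+2) k * φ k =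
     q*q^m*X * ∑ k ∈ Finset.range (N+1), cco q c (m+1) k * φ k
     + q*q^m*c*(1-q*q^m) * ∑ k ∈ Finset.range (N+1), rco q c m k * φ k
     + (1-q*q^m) * ∑ k ∈ Finset.range (N+1), sco q c m k * φ k
     + c*(1-q*q^m)^2 * ∑ k ∈ Finset.range (N+1), cco q c m k * φ k := by
  have T := co_tel φ
    (fun k => (1-c*q*q^m)^2*cco q c (m+2) k - q*q^m*((1-c*(q^k)^2)^2/(q^k)^2*cco q c (m+1) k) - q*q^m*c*(1-q*q^m)*rco q c m k - (1-q*q^m)*sco q c m k - c*(1-q*q^m)^2*cco q c m k)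
    (fun k => q*q^m*cco q c (m+1) k/(q^k)^2)
    (by
      have n5 : q^2*q^m-1 ≠ 0 := by
        intro h; apply hq1 (m+1); linear_combination -h
      have n6 : q*q^m-1 ≠ 0 := by
        intro h; apply hq1 m; linear_combination -h
      have n7 := pow_ne_zero m hq
      have n9 := hc m
      have n10 : 1-c*q*q^m ≠ 0 := by
        intro h; apply hc (m+1); linear_combination h
      have e3 : q^(m+1) = q*q^m := by ring
      simp only [cco, rco, sco, rhoR, rhoS, qp_zero, mul_zero, pow_zero, e3]
      have e4 : 1 - c*(q*q^m) ≠ 0 := by rwa [← mul_assoc]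
      generalize q^m = M at *
      have e5 : 1 - 1/(q*M) ≠ 0 := by
        intro h; apply n6; field_simp at h; simpa using h
      have e6 : 1 - 1/(q*(q*M)) ≠ 0 := by
        intro h; apply n5; field_simp at h; simpa using h
      field_simp
      ring)
    (by
      intro k
      have n5 : q^2*q^m-1 ≠ 0 := by
        intro h; apply hq1 (m+1); linear_combination -h
      have n6 : q*q^m-1 ≠ 0 := by
        intro h; apply hq1 m; linear_combination -h
      have n7 := pow_ne_zero m hq
      have n8 := pow_ne_zero k hq
      have n9 := hc m
      have n10 : 1-c*q*q^m ≠ 0 := by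
        intro h; apply hc (m+1); linear_combination h
      simp only [cco, rco, sco, rhoR, rhoS, show 2*(k+1) = 2*k+1+1 by ring,
        show m+1+1 = m+2 by ring]
      simp only [qp_d1 q hq hq1 m, qp_d2 q hq hq1 m, qp_c1 q c hc m, qp_c2 q c hc m]
      simp only [qp_succ]
      have n1 := qp_ne q q hq1 k
      have n2 := qp_ne q c hc k
      have n2' := qp_ne q c hc (2*k)
      have n3 := hq1 k
      have n4 := hc k
      have f1 : q^(2*k) = (q^k)^2 := by ring
      have f2 : q^(2*k+1) = q*(q^k)^2 := by ring
      have n11 := hc (2*k)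
      have n12 := hc (2*k+1)
      rw [f1] at n11
      rw [f2] at n12
      have e1 : q^(m+2) = q^2*q^m := by ring
      have e2 : q^(k+1) = q*q^k := by ring
      have e3 : q^(m+1) = q*q^m := by ring
      have e4 : 1 - c*(q*q^m) ≠ 0 := by rwa [← mul_assoc]
      generalize qPoch q ((q^(m+2))⁻¹) k = Y at *
      generalize qPoch q (c*q^m) k = Z at *
      rw [f1, f2, e2]
      try rw [e1]
      try rw [e3]
      generalize qPoch q q k = G1 at *
      generalize qPoch q c k = G2 at *
      generalize qPoch q c (2*k) = G3 at *
      clear hq1 hc hφ f1 f2 e1 e2 e3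
      generalize q^m = M at *
      generalize q^k = K at *
      have e5 : 1 - 1/(q*M) = (q*M-1)/(q*M) := by field_simp
      have e6 : 1 - 1/(q*(q*M)) = (q^2*M-1)/(q^2*M) := by field_simp
      have n13 : 1 - c*q*K^2 ≠ 0 := by intro h; apply n12; linear_combination h
      have n14 : 1 - q*c*K^2 ≠ 0 := by intro h; apply n12; linear_combination h
      have n15 : 1 - q*K^2*c ≠ 0 := by intro h; apply n12; linear_combination h
      have n16 : 1 - q*c*M ≠ 0 := by intro h; apply n10; linear_combination h
      try rw [e5]
      try rw [e6]
      field_simp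
      ring) N
  have v1 : cco q c (m+1) N = 0 := by simp [cco, qp_van q hq (m+1) N hN]
  simp only [v1] at T
  simp only [Finset.mul_sum, ← Finset.sum_add_distrib]
  rw [← sub_eq_zero, ← Finset.sum_sub_distrib]
  simp only [mul_zero, zero_div, zero_mul] at T
  rw [← T]
  refine Finset.sum_congr rfl fun k _ => ?_
  rw [hφ]
  have n8 := pow_ne_zero k hq
  field_simp
  ring

set_option maxHeartbeats 2000000 in
lemma c_rec2 (q c X : F) (hq : q ≠ 0) (hq1 : ∀ j : ℕ, 1 - q * q^j ≠ 0)
    (hc : ∀ j : ℕ, 1 - c * q^j ≠ 0) (φ : ℕ → F)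
    (hφ : ∀ k, φ (k+1) = ((1 - c * (q^k)^2)^2 - (q^k)^2*X) * φ k) (m N : ℕ) (hN : m + 1 < N) :
    (1-c*q*q^m) * ∑ k ∈ Finset.range (N+1), rco q c (m+1) k * φ k =
     q*q^m*X * ∑ k ∈ Finset.range (N+1), cco q c (m+1) k * φ k
     + (1-q*q^m) * ∑ k ∈ Finset.range (N+1), sco q c m k * φ k := by
  have T := co_tel φ
    (fun k => (1-c*q*q^m)*rco q c (m+1) k - q*q^m*((1-c*(q^k)^2)^2/(q^k)^2*cco q c (m+1) k) - (1-q*q^m)*sco q c m k)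
    (fun k => q*q^m*cco q c (m+1) k/(q^k)^2)
    (by
      have n5 : q^2*q^m-1 ≠ 0 := by
        intro h; apply hq1 (m+1); linear_combination -h
      have n6 : q*q^m-1 ≠ 0 := by
        intro h; apply hq1 m; linear_combination -h
      have n7 := pow_ne_zero m hq
      have n9 := hc m
      have n10 : 1-c*q*q^m ≠ 0 := by
        intro h; apply hc (m+1); linear_combination h
      have e3 : q^(m+1) = q*q^m := by ring
      simp only [cco, rco, sco, rhoR, rhoS, qp_zero, mul_zero, pow_zero, e3]
      have e4 : 1 - c*(q*q^m) ≠ 0 := by rwa [← mul_assoc]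
      generalize q^m = M at *
      have e5 : 1 - 1/(q*M) ≠ 0 := by
        intro h; apply n6; field_simp at h; simpa using h
      have e6 : 1 - 1/(q*(q*M)) ≠ 0 := by
        intro h; apply n5; field_simp at h; simpa using h
      field_simp
      ring)
    (by
      intro k
      have n5 : q^2*q^m-1 ≠ 0 := by
        intro h; apply hq1 (m+1); linear_combination -h
      have n6 : q*q^m-1 ≠ 0 := by
        intro h; apply hq1 m; linear_combination -h
      have n7 := pow_ne_zero m hq
      have n8 := pow_ne_zero k hq
      have n9 := hc m
      have n10 : 1-c*q*q^m ≠ 0 := by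
        intro h; apply hc (m+1); linear_combination h
      simp only [cco, rco, sco, rhoR, rhoS, show 2*(k+1) = 2*k+1+1 by ring,
        show m+1+1 = m+2 by ring]
      simp only [qp_d1 q hq hq1 m, qp_d2 q hq hq1 m, qp_c1 q c hc m, qp_c2 q c hc m]
      simp only [qp_succ]
      have n1 := qp_ne q q hq1 k
      have n2 := qp_ne q c hc k
      have n2' := qp_ne q c hc (2*k)
      have n3 := hq1 k
      have n4 := hc k
      have f1 : q^(2*k) = (q^k)^2 := by ring
      have f2 : q^(2*k+1) = q*(q^k)^2 := by ring
      have n11 := hc (2*k)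
      have n12 := hc (2*k+1)
      rw [f1] at n11
      rw [f2] at n12
      have e1 : q^(m+2) = q^2*q^m := by ring
      have e2 : q^(k+1) = q*q^k := by ring
      have e3 : q^(m+1) = q*q^m := by ring
      have e4 : 1 - c*(q*q^m) ≠ 0 := by rwa [← mul_assoc]
      generalize qPoch q ((q^(m+2))⁻¹) k = Y at *
      generalize qPoch q (c*q^m) k = Z at *
      rw [f1, f2, e2]
      try rw [e1]
      try rw [e3]
      generalize qPoch q q k = G1 at *
      generalize qPoch q c k = G2 at *
      generalize qPoch q c (2*k) = G3 at *
      clear hq1 hc hφ f1 f2 e1 e2 e3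
      generalize q^m = M at *
      generalize q^k = K at *
      have e5 : 1 - 1/(q*M) = (q*M-1)/(q*M) := by field_simp
      have e6 : 1 - 1/(q*(q*M)) = (q^2*M-1)/(q^2*M) := by field_simp
      have n13 : 1 - c*q*K^2 ≠ 0 := by intro h; apply n12; linear_combination h
      have n14 : 1 - q*c*K^2 ≠ 0 := by intro h; apply n12; linear_combination h
      have n15 : 1 - q*K^2*c ≠ 0 := by intro h; apply n12; linear_combination h
      have n16 : 1 - q*c*M ≠ 0 := by intro h; apply n10; linear_combination h
      try rw [e5]
      try rw [e6]
      field_simp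
      ring) N
  have v1 : cco q c (m+1) N = 0 := by simp [cco, qp_van q hq (m+1) N hN]
  simp only [v1] at T
  simp only [Finset.mul_sum, ← Finset.sum_add_distrib]
  rw [← sub_eq_zero, ← Finset.sum_sub_distrib]
  simp only [mul_zero, zero_div, zero_mul] at T
  rw [← T]
  refine Finset.sum_congr rfl fun k _ => ?_
  rw [hφ]
  have n8 := pow_ne_zero k hq
  field_simp
  ring

set_option maxHeartbeats 2000000 in
lemma c_rec3 (q c X : F) (hq : q ≠ 0) (hq1 : ∀ j : ℕ, 1 - q * q^j ≠ 0)
    (hc : ∀ j : ℕ, 1 - c * q^j ≠ 0) (φ : ℕ → F)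
    (hφ : ∀ k, φ (k+1) = ((1 - c * (q^k)^2)^2 - (q^k)^2*X) * φ k) (m N : ℕ) (hN : m + 1 < N) :
    (1-c*q*q^m) * ∑ k ∈ Finset.range (N+1), sco q c (m+1) k * φ k =
     X * ∑ k ∈ Finset.range (N+1), cco q c (m+1) k * φ k
     + c*(1-q*q^m) * ∑ k ∈ Finset.range (N+1), rco q c m k * φ k := by
  have T := co_tel φ
    (fun k => (1-c*q*q^m)*sco q c (m+1) k - ((1-c*(q^k)^2)^2/(q^k)^2*cco q c (m+1) k) - c*(1-q*q^m)*rco q c m k)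
    (fun k => cco q c (m+1) k/(q^k)^2)
    (by
      have n5 : q^2*q^m-1 ≠ 0 := by
        intro h; apply hq1 (m+1); linear_combination -h
      have n6 : q*q^m-1 ≠ 0 := by
        intro h; apply hq1 m; linear_combination -h
      have n7 := pow_ne_zero m hq
      have n9 := hc m
      have n10 : 1-c*q*q^m ≠ 0 := by
        intro h; apply hc (m+1); linear_combination h
      have e3 : q^(m+1) = q*q^m := by ring
      simp only [cco, rco, sco, rhoR, rhoS, qp_zero, mul_zero, pow_zero, e3]
      have e4 : 1 - c*(q*q^m) ≠ 0 := by rwa [← mul_assoc]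
      generalize q^m = M at *
      have e5 : 1 - 1/(q*M) ≠ 0 := by
        intro h; apply n6; field_simp at h; simpa using h
      have e6 : 1 - 1/(q*(q*M)) ≠ 0 := by
        intro h; apply n5; field_simp at h; simpa using h
      field_simp
      ring)
    (by
      intro k
      have n5 : q^2*q^m-1 ≠ 0 := by
        intro h; apply hq1 (m+1); linear_combination -h
      have n6 : q*q^m-1 ≠ 0 := by
        intro h; apply hq1 m; linear_combination -h
      have n7 := pow_ne_zero m hq
      have n8 := pow_ne_zero k hq
      have n9 := hc m
      have n10 : 1-c*q*q^m ≠ 0 := by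
        intro h; apply hc (m+1); linear_combination h
      simp only [cco, rco, sco, rhoR, rhoS, show 2*(k+1) = 2*k+1+1 by ring,
        show m+1+1 = m+2 by ring]
      simp only [qp_d1 q hq hq1 m, qp_d2 q hq hq1 m, qp_c1 q c hc m, qp_c2 q c hc m]
      simp only [qp_succ]
      have n1 := qp_ne q q hq1 k
      have n2 := qp_ne q c hc k
      have n2' := qp_ne q c hc (2*k)
      have n3 := hq1 k
      have n4 := hc k
      have f1 : q^(2*k) = (q^k)^2 := by ring
      have f2 : q^(2*k+1) = q*(q^k)^2 := by ring
      have n11 := hc (2*k)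
      have n12 := hc (2*k+1)
      rw [f1] at n11
      rw [f2] at n12
      have e1 : q^(m+2) = q^2*q^m := by ring
      have e2 : q^(k+1) = q*q^k := by ring
      have e3 : q^(m+1) = q*q^m := by ring
      have e4 : 1 - c*(q*q^m) ≠ 0 := by rwa [← mul_assoc]
      generalize qPoch q ((q^(m+2))⁻¹) k = Y at *
      generalize qPoch q (c*q^m) k = Z at *
      rw [f1, f2, e2]
      try rw [e1]
      try rw [e3]
      generalize qPoch q q k = G1 at *
      generalize qPoch q c k = G2 at *
      generalize qPoch q c (2*k) = G3 at *
      clear hq1 hc hφ f1 f2 e1 e2 e3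
      generalize q^m = M at *
      generalize q^k = K at *
      have e5 : 1 - 1/(q*M) = (q*M-1)/(q*M) := by field_simp
      have e6 : 1 - 1/(q*(q*M)) = (q^2*M-1)/(q^2*M) := by field_simp
      have n13 : 1 - c*q*K^2 ≠ 0 := by intro h; apply n12; linear_combination h
      have n14 : 1 - q*c*K^2 ≠ 0 := by intro h; apply n12; linear_combination h
      have n15 : 1 - q*K^2*c ≠ 0 := by intro h; apply n12; linear_combination h
      have n16 : 1 - q*c*M ≠ 0 := by intro h; apply n10; linear_combination h
      try rw [e5]
      try rw [e6]
      field_simp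
      ring) N
  have v1 : cco q c (m+1) N = 0 := by simp [cco, qp_van q hq (m+1) N hN]
  simp only [v1] at T
  simp only [Finset.mul_sum, ← Finset.sum_add_distrib]
  rw [← sub_eq_zero, ← Finset.sum_sub_distrib]
  simp only [mul_zero, zero_div, zero_mul] at T
  rw [← T]
  refine Finset.sum_congr rfl fun k _ => ?_
  rw [hφ]
  have n8 := pow_ne_zero k hq
  field_simp
  ring

end

section
variable {F : Type*} [Field F]

lemma trunc2 (f φ : ℕ → F) (N : ℕ) (hN : 1 ≤ N) (hf : ∀ k, 2 ≤ k → f k = 0) :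
    ∑ k ∈ Finset.range (N+1), f k * φ k = f 0 * φ 0 + f 1 * φ 1 := by
  induction N, hN using Nat.le_induction with
  | base => simp [Finset.sum_range_succ]
  | succ N hN ih => rw [Finset.sum_range_succ, ih, hf (N+1) (by omega)]; ring

lemma trunc1 (f φ : ℕ → F) (N : ℕ) (hf : ∀ k, 1 ≤ k → f k = 0) :
    ∑ k ∈ Finset.range (N+1), f k * φ k = f 0 * φ 0 := by
  induction N with
  | zero => simp
  | succ N ih => rw [Finset.sum_range_succ, ih, hf (N+1) (by omega)]; ring

lemma gen_main (q c x : F) (hq : q ≠ 0) (hx : x ≠ 0) (hq1 : ∀ j : ℕ, 1 - q * q^j ≠ 0)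
    (hc : ∀ j : ℕ, 1 - c * q^j ≠ 0) (ψ χ φ : ℕ → F)
    (hψ0 : ψ 0 = 1) (hχ0 : χ 0 = 1) (hφ0 : φ 0 = 1)
    (hψ : ∀ k, ψ (k+1) = (1 - x * (q^k)^2) * ψ k)
    (hχ : ∀ k, χ (k+1) = (1/x - (q^k)^2) * χ k)
    (hφ : ∀ k, φ (k+1) = ((1 - c * (q^k)^2)^2 - (q^k)^2*((x-c)^2/x)) * φ k)
    (N m : ℕ) (hN : m + 1 ≤ N) :
    (∑ k ∈ Finset.range (N+1), aco q c m k * ψ k) * (∑ k ∈ Finset.range (N+1), bco q c m k * χ k)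
      = ∑ k ∈ Finset.range (N+1), cco q c m k * φ k ∧
    (∑ k ∈ Finset.range (N+1), aco q c (m+1) k * ψ k) *
      (∑ k ∈ Finset.range (N+1), bco q c (m+1) k * χ k)
      = ∑ k ∈ Finset.range (N+1), cco q c (m+1) k * φ k ∧
    (1-c/x)*((∑ k ∈ Finset.range (N+1), aco q c (m+1) k * ψ k) *
      (∑ k ∈ Finset.range (N+1), bco q c m k * χ k))
      = ∑ k ∈ Finset.range (N+1), rco q c m k * φ k ∧
    (x-c)*((∑ k ∈ Finset.range (N+1), aco q c m k * ψ k) *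
      (∑ k ∈ Finset.range (N+1), bco q c (m+1) k * χ k))
      = ∑ k ∈ Finset.range (N+1), sco q c m k * φ k := by
  induction m with
  | zero =>
    have z0 : ∀ k, 1 ≤ k → qPoch q ((q^0)⁻¹) k = 0 := fun k hk => qp_van q hq 0 k (by omega)
    have z1 : ∀ k, 2 ≤ k → qPoch q ((q^(0+1))⁻¹) k = 0 :=
      fun k hk => qp_van q hq (0+1) k (by omega)
    rw [trunc1 (aco q c 0) ψ N (fun k hk => by simp only [aco, z0 k hk]; simp),
      trunc1 (bco q c 0) χ N (fun k hk => by simp only [bco, z0 k hk]; simp),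
      trunc1 (cco q c 0) φ N (fun k hk => by simp only [cco, z0 k hk]; simp),
      trunc2 (aco q c (0+1)) ψ N hN (fun k hk => by simp only [aco, z1 k hk]; simp),
      trunc2 (bco q c (0+1)) χ N hN (fun k hk => by simp only [bco, z1 k hk]; simp),
      trunc2 (cco q c (0+1)) φ N hN (fun k hk => by simp only [cco, z1 k hk]; simp),
      trunc2 (rco q c 0) φ N hN (fun k hk => by simp only [rco, z1 k hk]; simp),
      trunc2 (sco q c 0) φ N hN (fun k hk => by simp only [sco, z1 k hk]; simp)]
    have p1 : ∀ a : F, qPoch q a 1 = 1 - a := fun a => by simp [qPoch]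
    have p2 : ∀ a : F, qPoch q a 2 = (1 - a) * (1 - a*q) := fun a => by
      simp [qPoch, Finset.prod_range_succ]
    have n1 : 1 - q ≠ 0 := by simpa using hq1 0
    have n2 : 1 - c ≠ 0 := by simpa using hc 0
    have n3 : 1 - c*q ≠ 0 := by simpa using hc 1
    have n3b : 1 - q*c ≠ 0 := by rwa [mul_comm]
    have n4 : q - 1 ≠ 0 := fun h => n1 (by linear_combination -h)
    have e1 : 1 - 1/q = (q-1)/q := by field_simp
    have e2 : 1 - q⁻¹ = (q-1)/q := by field_simp
    rw [show ψ 1 = _ from hψ 0, show χ 1 = _ from hχ 0, show φ 1 = _ from hφ 0, hψ0, hχ0, hφ0]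
    refine ⟨?_, ?_, ?_, ?_⟩ <;>
    · simp only [aco, bco, cco, rco, sco, rhoR, rhoS, qp_zero, zero_add, pow_zero, pow_one, mul_zero,
        mul_one, p1, p2, Nat.sub_self, Nat.zero_div, zero_mul, one_pow, e1, e2, inv_one, div_one, one_mul]
      try field_simp
      try ring
  | succ m ih =>
    obtain ⟨h1, h2, h3, h4⟩ := ih (by omega)
    have ra := a_rec q c x hq hq1 hc ψ hψ m N (by omega)
    have rb := b_rec q c x hq hx hq1 hc χ hχ m N (by omega)
    have r1 := c_rec1 q c _ hq hq1 hc φ hφ m N (by omega)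
    have r2 := c_rec2 q c _ hq hq1 hc φ hφ m N (by omega)
    have r3 := c_rec3 q c _ hq hq1 hc φ hφ m N (by omega)
    have hu : 1-c*q*q^m ≠ 0 := by
      intro h; apply hc (m+1); linear_combination h
    rw [← h1, ← h2, ← h3, ← h4] at r1
    rw [← h2, ← h4] at r2
    rw [← h2, ← h3] at r3
    refine ⟨h2, ?_, ?_, ?_⟩
    · apply mul_left_cancel₀ (pow_ne_zero 2 hu)
      rw [r1, show ∀ u a b : F, u^2*(a*b) = (u*a)*(u*b) by intros; ring, ra, rb]
      field_simp
      try ring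
    · apply mul_left_cancel₀ hu
      rw [r2, show ∀ u t a b : F, u*(t*(a*b)) = t*((u*a)*b) by intros; ring, ra]
      field_simp
      try ring
    · apply mul_left_cancel₀ hu
      rw [r3, show ∀ u t a b : F, u*(t*(a*b)) = t*(a*(u*b)) by intros; ring, rb]
      field_simp
      try ring

lemma gen_final (q c x : F) (hq : q ≠ 0) (hx : x ≠ 0) (hq1 : ∀ j : ℕ, 1 - q * q^j ≠ 0)
    (hc : ∀ j : ℕ, 1 - c * q^j ≠ 0) (n : ℕ) :
    (∑ k ∈ Finset.range (n + 1),
        qPoch q ((q ^ n)⁻¹) k * qPoch (q ^ 2) x k * q ^ k /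
          (qPoch q q k * qPoch q c k)) *
      (∑ k ∈ Finset.range (n + 1),
        qPoch q ((q ^ n)⁻¹) k * qPoch (q ^ 2) x k * c ^ k * q ^ (n * k) *
          (q ^ (k * (k - 1) / 2))⁻¹ /
          (qPoch q q k * qPoch q c k * x ^ k)) =
    ∑ k ∈ Finset.range (n + 1),
        qPoch q ((q ^ n)⁻¹) k * qPoch q (c * q ^ n) k * qPoch (q ^ 2) x k *
          qPoch (q ^ 2) (c ^ 2 / x) k * q ^ k /
          (qPoch q q k * qPoch q c k * qPoch q c (2 * k)) := by
  have e : ∀ k : ℕ, (q^2)^k = (q^k)^2 := fun k => by ring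
  have h := (gen_main q c x hq hx hq1 hc (fun k => qPoch (q^2) x k)
    (fun k => qPoch (q^2) x k / x^k) (fun k => qPoch (q^2) x k * qPoch (q^2) (c^2/x) k)
    (by simp [qp_zero]) (by simp [qp_zero]) (by simp [qp_zero])
    (fun k => by simp only [qp_succ, e]; ring)
    (fun k => by
      simp only [qp_succ, e, pow_succ x]
      field_simp)
    (fun k => by
      simp only [qp_succ, e]
      field_simp
      ring) (n+1) n le_rfl).1
  have z := qp_van q hq n (n+1) (by omega)
  rw [Finset.sum_range_succ, Finset.sum_range_succ _ (n+1), Finset.sum_range_succ _ (n+1)] at h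
  simp only [aco, bco, cco, z, zero_mul, zero_div, add_zero] at h
  convert h using 2
  · refine Finset.sum_congr rfl fun k _ => ?_
    ring
  · refine Finset.sum_congr rfl fun k _ => ?_
    have := qp_ne q q hq1 k
    have := qp_ne q c hc k
    field_simp
  · ring
end

lemma am_inj : Function.Injective (algebraMap (MvPolynomial (Fin 3) ℚ) F3) :=
  IsFractionRing.injective _ _

lemma F3_q1 (j : ℕ) : 1 - q * q^j ≠ 0 := by
  intro h
  have h2 : algebraMap (MvPolynomial (Fin 3) ℚ) F3
      (1 - MvPolynomial.X 0 * MvPolynomial.X 0 ^ j) = algebraMap _ F3 0 := by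
    simpa [q] using h
  have h3 := congrArg (MvPolynomial.eval (fun _ => (0:ℚ))) (am_inj h2)
  simp at h3

lemma F3_c (j : ℕ) : 1 - c * q^j ≠ 0 := by
  intro h
  have h2 : algebraMap (MvPolynomial (Fin 3) ℚ) F3
      (1 - MvPolynomial.X 1 * MvPolynomial.X 0 ^ j) = algebraMap _ F3 0 := by
    simpa [q, c] using h
  have h3 := congrArg (MvPolynomial.eval (fun _ => (0:ℚ))) (am_inj h2)
  simp at h3

lemma F3_X (i : Fin 3) : algebraMap (MvPolynomial (Fin 3) ℚ) F3 (MvPolynomial.X i) ≠ 0 := by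
  rw [Ne, map_eq_zero_iff _ am_inj]
  exact MvPolynomial.X_ne_zero i

theorem q_Clausen_Orr_second (n : ℕ) :
    (∑ k ∈ Finset.range (n + 1),
        qPoch q ((q ^ n)⁻¹) k * qPoch (q ^ 2) x k * q ^ k /
          (qPoch q q k * qPoch q c k)) *
      (∑ k ∈ Finset.range (n + 1),
        qPoch q ((q ^ n)⁻¹) k * qPoch (q ^ 2) x k * c ^ k * q ^ (n * k) *
          (q ^ (k * (k - 1) / 2))⁻¹ /
          (qPoch q q k * qPoch q c k * x ^ k)) =
    ∑ k ∈ Finset.range (n + 1),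
        qPoch q ((q ^ n)⁻¹) k * qPoch q (c * q ^ n) k * qPoch (q ^ 2) x k *
          qPoch (q ^ 2) (c ^ 2 / x) k * q ^ k /
          (qPoch q q k * qPoch q c k * qPoch q c (2 * k)) := by
  exact gen_final q c x (F3_X 0) (F3_X 2) F3_q1 F3_c n
end

section
/- Let n be a non-negative integer and s an integer with 0 ≤ s ≤ n. Then, as an identity in the field of rational functions Q(q, a, x): (∑_{k=s}^{n} (q^{-n};q)_k (a;q)_k (x;q)_k q^k / ((q;q)_{k-s} (q;q)_{k+s})) · (∑_{k=s}^{n} (q^{-n};q)_k (a;q)_k (q/x;q)_k q^k / ((q;q)_{k-s} (q;q)_{k+s})) = ((q^{-n};q)_s (a;q)_s a^{n-s} q^{(n+1)s - s^2} / ((q^{n+1};q)_s (q/a;q)_s)) · ∑_{k=s}^{n} (q^{-n};q)_k (q^{n+1};q)_k (a;q)_k (q/a;q)_k (x;q)_k (q/x;q)_k q^k / ((q;q)_{k-s} (q;q)_{k+s} (q;q)_{2k}). -/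
open Finset

theorem qP_zero {F : Type*} [Field F] (q b : F) : qPoch q b 0 = 1 := by simp [qPoch]

theorem qP_succ {F : Type*} [Field F] (q b : F) (j : ℕ) :
    qPoch q b (j + 1) = qPoch q b j * (1 - b * q ^ j) := by
  simp [qPoch, Finset.prod_range_succ]

theorem qP_shift {F : Type*} [Field F] (q b : F) (j : ℕ) :
    (1 - b) * qPoch q (b * q) j = qPoch q b j * (1 - b * q ^ j) := by
  rw [← qP_succ, qPoch, qPoch, Finset.prod_range_succ', mul_comm]
  congr 1
  · apply Finset.prod_congr rfl
    intros; ring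
  · simp

theorem qP_shift' {F : Type*} [Field F] (q b c : F) (j : ℕ) (hc : c = b * q) (hb : 1 - b ≠ 0) :
    qPoch q c j = qPoch q b j * (1 - b * q ^ j) / (1 - b) := by
  rw [hc, eq_div_iff hb, ← qP_shift]; ring

theorem qP_add {F : Type*} [Field F] (q b : F) (s j : ℕ) :
    qPoch q b (s + j) = qPoch q b s * qPoch q (b * q ^ s) j := by
  simp only [qPoch, Finset.prod_range_add]
  congr 1
  apply Finset.prod_congr rfl
  intros; ring

theorem qP_vanish {F : Type*} [Field F] (q : F) (hq : q ≠ 0) (n k : ℕ) (h : n < k) :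
    qPoch q (q ^ n)⁻¹ k = 0 := by
  rw [qPoch, Finset.prod_eq_zero (Finset.mem_range.2 h)]
  have : q ^ n ≠ 0 := pow_ne_zero _ hq
  field_simp; simp

theorem qP_ne {F : Type*} [Field F] (q b : F) (n : ℕ) (h : ∀ j, 1 - b * q ^ j ≠ 0) :
    qPoch q b n ≠ 0 := by
  rw [qPoch]; exact Finset.prod_ne_zero_iff.2 (fun j _ => h j)

theorem tele {F : Type*} [Field F] (f G : ℕ → F) (h0 : G 0 = 0)
    (h : ∀ j, f j = G (j + 1) - G j) (K : ℕ) : ∑ j ∈ Finset.range K, f j = G K := by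
  induction K with
  | zero => simp [h0]
  | succ k ih => rw [Finset.sum_range_succ, ih, h]; ring

noncomputable def ft {F : Type*} [Field F] (q A X C : F) (n j : ℕ) : F :=
  qPoch q (q ^ n)⁻¹ j * qPoch q A j * qPoch q X j * q ^ j / (qPoch q q j * qPoch q C j)

noncomputable def St {F : Type*} [Field F] (q A X C : F) (n j : ℕ) : F :=
  qPoch q (q ^ n)⁻¹ j * qPoch q (C * q ^ n) j * qPoch q A j * qPoch q (C / A) j *
    qPoch q X j * qPoch q (C / X) j * q ^ j / (qPoch q q j * qPoch q C j * qPoch q C (2 * j))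

/-- the term of `R_{n+1}` -/
noncomputable def Rt {F : Type*} [Field F] (q A X C : F) (n j : ℕ) : F :=
  qPoch q (q ^ n)⁻¹ j * qPoch q (C * q ^ (n + 1)) j * qPoch q A (j + 1) * qPoch q (C / A) j *
    qPoch q X j * qPoch q (C / X) j * q ^ j /
    (qPoch q q j * qPoch q C j * qPoch q C (2 * j + 1))

/-- the term of `Z_{n+1}` -/
noncomputable def Zt {F : Type*} [Field F] (q A X C : F) (n j : ℕ) : F :=
  A * qPoch q (q ^ n)⁻¹ j * qPoch q (C * q ^ (n + 1)) j * qPoch q A j * qPoch q (C / A) (j + 1) *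
    qPoch q X j * qPoch q (C / X) j * q ^ j /
    (qPoch q q j * qPoch q C j * qPoch q C (2 * j + 1))

theorem f_rec {F : Type*} [Field F] (q A X C : F) (hq : q ≠ 0)
    (hq1 : ∀ k : ℕ, 1 - q ^ (k + 1) ≠ 0) (hC : ∀ k : ℕ, 1 - C * q ^ k ≠ 0) (n K : ℕ)
    (hK : n + 3 ≤ K) :
    (1 - C * q ^ (n + 1)) * ∑ j ∈ Finset.range K, ft q A X C (n + 2) j =
      (A + X - (A * X + C) * q ^ (n + 1)) * ∑ j ∈ Finset.range K, ft q A X C (n + 1) j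
      - A * X * (1 - q ^ (n + 1)) * ∑ j ∈ Finset.range K, ft q A X C n j := by
  have key := tele (fun j => (1 - C * q ^ (n + 1)) * ft q A X C (n + 2) j -
      (A + X - (A * X + C) * q ^ (n + 1)) * ft q A X C (n + 1) j
      + A * X * (1 - q ^ (n + 1)) * ft q A X C n j)
    (fun j => qPoch q A j * qPoch q X j * qPoch q (q ^ (n + 2))⁻¹ j * (1 - q ^ j) *
      (1 - C * q ^ j / q) / ((1 - (q ^ (n + 2))⁻¹) * (qPoch q q j * qPoch q C j)))
    (by simp) ?_ K
  · rw [qP_vanish q hq _ _ (by omega)] at key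
    simp only [Finset.sum_add_distrib, Finset.sum_sub_distrib, ← Finset.mul_sum] at key
    linear_combination key
  · intro j
    have hT : q ^ (n + 1) ≠ 0 := pow_ne_zero _ hq
    have h1 := hq1 n
    have h2 := hq1 (n + 1)
    have h2' : 1 - q * q ^ (n + 1) ≠ 0 := by rw [← pow_succ']; exact h2
    have g1 : 1 - (q ^ (n + 2))⁻¹ ≠ 0 := by
      rw [pow_succ']
      intro h; apply h2'
      have : q * q ^ (n + 1) ≠ 0 := mul_ne_zero hq hT
      field_simp at h; linear_combination -h
    have g2 : 1 - (q ^ (n + 1))⁻¹ ≠ 0 := by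
      intro h; apply h1
      field_simp at h; linear_combination -h
    have hqj : qPoch q q j ≠ 0 := qP_ne _ _ _ (fun k => by rw [← pow_succ']; exact hq1 k)
    have hCj : qPoch q C j ≠ 0 := qP_ne _ _ _ hC
    have e1 := hq1 j
    have e1' : 1 - q * q ^ j ≠ 0 := by rw [← pow_succ']; exact e1
    have e2 := hC j
    simp only [ft, qP_succ]
    rw [qP_shift' q (q ^ (n + 1))⁻¹ (q ^ n)⁻¹ j (by rw [pow_succ]; field_simp) g2,
      qP_shift' q (q ^ (n + 2))⁻¹ (q ^ (n + 1))⁻¹ j (by rw [pow_succ q (n + 1)]; field_simp) g1]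
    have p2 : q ^ (n + 2) = q * q ^ (n + 1) := pow_succ' _ _
    have p3 : q ^ (j + 1) = q * q ^ j := pow_succ' _ _
    rw [p2] at g1 ⊢
    rw [p3]
    generalize q ^ (n + 1) = T at *
    generalize q ^ j = t at *
    generalize qPoch q A j = y1 at *
    generalize qPoch q X j = y2 at *
    generalize qPoch q (q * T)⁻¹ j = y3 at *
    generalize qPoch q q j = y4 at *
    generalize qPoch q C j = y5 at *
    have r1 : (1 - (q * T)⁻¹) = (q * T - 1) / (q * T) := by field_simp
    have r2 : (1 - T⁻¹) = (T - 1) / T := by field_simp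
    have s1 : q * T - 1 ≠ 0 := fun h => h2' (by linear_combination -h)
    have s2 : T - 1 ≠ 0 := fun h => h1 (by linear_combination -h)
    have s1' : T * q - 1 ≠ 0 := by rwa [mul_comm]
    have e1'' : 1 - t * q ≠ 0 := by rwa [mul_comm]
    rw [r1, r2]
    field_simp
    ring

theorem inv_ne {F : Type*} [Field F] (T : F) (hT : T ≠ 0) (h : 1 - T ≠ 0) : 1 - T⁻¹ ≠ 0 := by
  intro h'; apply h; field_simp at h'; linear_combination -h'

theorem step_i {F : Type*} [Field F] (q A X C : F) (hq : q ≠ 0) (hA : A ≠ 0)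
    (hq1 : ∀ k : ℕ, 1 - q ^ (k + 1) ≠ 0) (hC : ∀ k : ℕ, 1 - C * q ^ k ≠ 0) (n j : ℕ) :
    (1 - C * q ^ (n + 1)) * Rt q A X C (n + 1) j =
      (1 - A * q ^ (n + 1)) * St q A X C (n + 1) j - (1 - q ^ (n + 1)) * Zt q A X C n j ∧
    (1 - C * q ^ (n + 1)) * Zt q A X C (n + 1) j =
      (A - C * q ^ (n + 1)) * St q A X C (n + 1) j - C * (1 - q ^ (n + 1)) * Rt q A X C n j := by
  have hT : q ^ (n + 1) ≠ 0 := pow_ne_zero _ hq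
  have h1 := hq1 n
  have g2 := inv_ne _ hT h1
  have hqj : qPoch q q j ≠ 0 := qP_ne _ _ _ (fun k => by rw [← pow_succ']; exact hq1 k)
  have hCj : qPoch q C j ≠ 0 := qP_ne _ _ _ hC
  have hCj2 : qPoch q C (2 * j) ≠ 0 := qP_ne _ _ _ hC
  have e2 := hC (2 * j)
  have e3 := hC (n + 1)
  have p4 : q ^ (2 * j) = (q ^ j) ^ 2 := by rw [mul_comm, pow_mul]
  simp only [St, Rt, Zt, qP_succ]
  rw [qP_shift' q (q ^ (n + 1))⁻¹ (q ^ n)⁻¹ j (by rw [pow_succ]; field_simp) g2,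
    qP_shift' q (C * q ^ (n + 1)) (C * q ^ (n + 1 + 1)) j (by ring) e3]
  rw [p4] at e2 ⊢
  generalize qPoch q (q ^ (n + 1))⁻¹ j = y1 at *
  generalize qPoch q (C * q ^ (n + 1)) j = y2 at *
  generalize q ^ (n + 1) = T at *
  generalize q ^ j = t at *
  generalize qPoch q A j = y3 at *
  generalize qPoch q X j = y4 at *
  generalize qPoch q q j = y5 at *
  generalize qPoch q C j = y6 at *
  generalize qPoch q (C / A) j = y7 at *
  generalize qPoch q (C / X) j = y8 at *
  generalize qPoch q C (2 * j) = y9 at *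
  have r2 : (1 - T⁻¹) = (T - 1) / T := by field_simp
  have s2 : T - 1 ≠ 0 := fun h => h1 (by linear_combination -h)
  rw [r2]
  constructor
  · field_simp
    ring
  · field_simp
    ring

set_option maxRecDepth 100000 in
set_option maxHeartbeats 4000000 in
theorem step_iii {F : Type*} [Field F] (q A X C : F) (hq : q ≠ 0) (hA : A ≠ 0) (hX : X ≠ 0)
    (hq1 : ∀ k : ℕ, 1 - q ^ (k + 1) ≠ 0) (hC : ∀ k : ℕ, 1 - C * q ^ k ≠ 0) (n K : ℕ)
    (hK : n + 3 ≤ K) (T g h Y : F) (hT' : T = q ^ (n + 1)) (hg : g = A - C * T)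
    (hh : h = 1 - A * T) (hY : Y = X + C / X) :
    (1 - C * T) ^ 2 * A * ∑ j ∈ Finset.range K, St q A X C (n + 2) j =
      (g ^ 2 + C * h ^ 2) * ∑ j ∈ Finset.range K, St q A X C (n + 1) j
      - (1 - T) * 2 * C * h * ∑ j ∈ Finset.range K, Zt q A X C n j
      - (1 - T) * 2 * C * g * ∑ j ∈ Finset.range K, Rt q A X C n j
      + A * C * (1 - T) ^ 2 * ∑ j ∈ Finset.range K, St q A X C n j
      + Y * (g * (1 - C * T) * ∑ j ∈ Finset.range K, Rt q A X C (n + 1) j -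
        C * (1 - T) * h * ∑ j ∈ Finset.range K, Rt q A X C n j) := by
  have key := tele (fun j => (g ^ 2 + C * h ^ 2) * St q A X C (n + 1) j
      - (1 - T) * 2 * C * h * Zt q A X C n j
      - (1 - T) * 2 * C * g * Rt q A X C n j
      + A * C * (1 - T) ^ 2 * St q A X C n j
      + Y * (g * (1 - C * T) * Rt q A X C (n + 1) j -
        C * (1 - T) * h * Rt q A X C n j) - (1 - C * T) ^ 2 * A * St q A X C (n + 2) j)
    (fun j => - A * (1 - C * T ^ 2) * (qPoch q A j * qPoch q (C / A) j *
      qPoch q X j * qPoch q (C / X) j) * qPoch q (q ^ (n + 2))⁻¹ j * qPoch q (C * q ^ n) j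
      * (1 - q ^ j) *
      (1 - C * q ^ j / q) * (1 - C * (q ^ j) ^ 2 / q) / ((1 - (q ^ (n + 2))⁻¹) * (1 - C * q ^ n) *
        (qPoch q q j * qPoch q C j * qPoch q C (2 * j))))
    (by simp) ?_ K
  · rw [qP_vanish q hq _ _ (by omega)] at key
    simp only [Finset.sum_add_distrib, Finset.sum_sub_distrib, ← Finset.mul_sum] at key
    linear_combination -key
  · intro j
    have hT : T ≠ 0 := hT' ▸ pow_ne_zero _ hq
    have h1 := hq1 n
    have h2 := hq1 (n + 1)
    have h2' : 1 - q * q ^ (n + 1) ≠ 0 := by rw [← pow_succ']; exact h2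
    have g1 : 1 - (q ^ (n + 2))⁻¹ ≠ 0 := inv_ne _ (pow_ne_zero _ hq) h2
    have g2 : 1 - (q ^ (n + 1))⁻¹ ≠ 0 := inv_ne _ (pow_ne_zero _ hq) h1
    have hqj : qPoch q q j ≠ 0 := qP_ne _ _ _ (fun k => by rw [← pow_succ']; exact hq1 k)
    have hCj : qPoch q C j ≠ 0 := qP_ne _ _ _ hC
    have hCj2 : qPoch q C (2 * j) ≠ 0 := qP_ne _ _ _ hC
    have e1 := hq1 j
    have e1' : 1 - q * q ^ j ≠ 0 := by rw [← pow_succ']; exact e1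
    have e2 := hC j
    have e3 := hC n
    have e4 := hC (n + 1)
    have e5 := hC (2 * j)
    have e6 := hC (2 * j + 1)
    have p4 : q ^ (2 * j) = (q ^ j) ^ 2 := by rw [mul_comm, pow_mul]
    have p5 : q ^ (2 * j + 1) = q * (q ^ j) ^ 2 := by rw [pow_succ', mul_comm 2, pow_mul]
    have p6 : 2 * (j + 1) = 2 * j + 1 + 1 := by ring
    have p2 : q ^ (n + 2) = q * T := by rw [hT']; exact pow_succ' _ _
    have p3 : q ^ (j + 1) = q * q ^ j := pow_succ' _ _
    have p7 : q ^ n = T / q := by rw [hT', pow_succ]; field_simp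
    simp only [St, Rt, Zt, p6, qP_succ]
    rw [qP_shift' q (q ^ (n + 1))⁻¹ (q ^ n)⁻¹ j (by rw [pow_succ]; field_simp) g2,
      qP_shift' q (q ^ (n + 2))⁻¹ (q ^ (n + 1))⁻¹ j (by rw [pow_succ q (n + 1)]; field_simp) g1]
    have q1 := qP_shift' q (C * q ^ n) (C * q ^ (n + 1)) j (by ring) e3
    have q2 := qP_shift' q (C * q ^ (n + 1)) (C * q ^ (n + 2)) j (by ring) e4
    rw [show n + 1 + 1 = n + 2 from rfl, q2, q1]
    rw [p5] at e6 ⊢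
    rw [p4] at e5 ⊢
    rw [p3]
    generalize qPoch q (C * q ^ n) j = y1 at *
    generalize qPoch q (q ^ (n + 2))⁻¹ j = y2 at *
    rw [p2] at g1 ⊢
    rw [← hT'] at *
    rw [p7] at e3 ⊢
    generalize q ^ j = t at *
    generalize qPoch q A j = y3 at *
    generalize qPoch q X j = y4 at *
    generalize qPoch q q j = y5 at *
    generalize qPoch q C j = y6 at *
    generalize qPoch q (C / A) j = y7 at *
    generalize qPoch q (C / X) j = y8 at *
    generalize qPoch q C (2 * j) = y9 at *
    have r1 : (1 - (q * T)⁻¹) = (T * q - 1) / (q * T) := by field_simp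
    have r2 : (1 - T⁻¹) = (T - 1) / T := by field_simp
    have r3 : (1 - C * (T / q)) = (q - C * T) / q := by field_simp
    have s1 : T * q - 1 ≠ 0 := fun h => h2' (by linear_combination -h)
    have s2 : T - 1 ≠ 0 := fun h => h1 (by linear_combination -h)
    have s3 : q - C * T ≠ 0 := by
      intro h; rw [r3, h] at e3; simp at e3
    have e1'' : 1 - t * q ≠ 0 := by rwa [mul_comm]
    rw [r1, r2, r3]
    obtain ⟨d1, hd1⟩ : ∃ d, d = T * q - 1 := ⟨_, rfl⟩
    have m1 : d1 ≠ 0 := hd1 ▸ s1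
    obtain ⟨d2, hd2⟩ : ∃ d, d = T - 1 := ⟨_, rfl⟩
    have m2 : d2 ≠ 0 := hd2 ▸ s2
    obtain ⟨d3, hd3⟩ : ∃ d, d = q - C * T := ⟨_, rfl⟩
    have m3 : d3 ≠ 0 := hd3 ▸ s3
    obtain ⟨d4, hd4⟩ : ∃ d, d = 1 - C * T := ⟨_, rfl⟩
    have m4 : d4 ≠ 0 := hd4 ▸ e4
    obtain ⟨d5, hd5⟩ : ∃ d, d = 1 - q * t := ⟨_, rfl⟩
    have m5 : d5 ≠ 0 := hd5 ▸ e1'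
    obtain ⟨d6, hd6⟩ : ∃ d, d = 1 - C * t := ⟨_, rfl⟩
    have m6 : d6 ≠ 0 := hd6 ▸ e2
    obtain ⟨d7, hd7⟩ : ∃ d, d = 1 - C * t ^ 2 := ⟨_, rfl⟩
    have m7 : d7 ≠ 0 := hd7 ▸ e5
    obtain ⟨d8, hd8⟩ : ∃ d, d = 1 - C * (q * t ^ 2) := ⟨_, rfl⟩
    have m8 : d8 ≠ 0 := hd8 ▸ e6
    rw [← hd1, ← hd2, ← hd3, ← hd4, ← hd5, ← hd6, ← hd7, ← hd8, hY]
    clear e1'' q1 q2 r1 r2 r3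
    field_simp
    simp only [hg, hh, hd1, hd2, hd3, hd4]
    have E2 : (A - C * T) * (T - 1) * (1 - C * T * t) - C * (1 - A * T) * (1 - T) * (T - t) =
      (T - 1) * ((A - C * t) * (1 - C * T ^ 2)) := by ring
    obtain ⟨z, hz⟩ : ∃ z, z = ((A - C * T) ^ 2 + C * (1 - A * T) ^ 2) * d7 +
      2 * C * (T - t) * ((1 - A * T) * (A - C * t) + (A - C * T) * (1 - t * A)) := ⟨_, rfl⟩
    have E1 : ((A - C * T) ^ 2 + C * (1 - A * T) ^ 2) * (T - 1) * d7 -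
                          C * (1 - A * T) * (1 - T) * 2 * (T - t) * (A - C * t) -
                        (A - C * T) * C * (1 - T) * 2 * (T - t) * (1 - t * A) = (T - 1) * z := by
      rw [hz]; ring
    have core : t * ((q * T - t) * ((q - C * T * t) * z +
        C * (q - C * T) * (T - 1) * A * (T - t) * d7) -
        (T * q - 1) * (q - C * T * t) * A * d7 * (1 - C * T) * (1 - C * T * t)) =
        (1 - C * T ^ 2) * (-(q * T - t) * (q - C * T * t) * (A - C * t) * (1 - t * A) *
        (1 + C * t ^ 2) + T * A * d7 * (1 - t) * (q - C * t) * (q - C * t ^ 2)) := by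
      rw [hz, hd7]; ring
    have D8 : 1 - C * q * t ^ 2 = d8 := by rw [hd8]; ring
    rw [E1, E2, D8, ← hd6]
    generalize q * T - t = a1 at *
    generalize q - C * T * t = a2 at *
    generalize A - C * t = a3 at *
    generalize 1 - t * A = a4 at *
    generalize q - C * T = a5 at *
    generalize T - t = a6 at *
    generalize T * q - 1 = a7 at *
    generalize 1 - C * T * t = a8 at *
    generalize 1 - C * T = a9 at *
    generalize 1 - C * T ^ 2 = a10 at *
    generalize 1 - t = a11 at *
    generalize q - C * t = a12 at *
    generalize q - C * t ^ 2 = a13 at *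
    linear_combination (y2 * y1 * y3 * y7 * y4 * y8 * (T - 1) * X * d6 * d8) * core

theorem alg_step {F : Type*} [Field F] (A X C W T p u0 u1 u2 v0 v1 v2 S0 S1 S2 Z R Z' R' g h : F)
    (hCT : 1 - C * T ≠ 0) (hW : C = X * W) (hg : g = A - C * T) (hh : h = 1 - A * T)
    (ru : (1 - C * T) * u2 = (A + X - (A * X + C) * T) * u1 - A * X * (1 - T) * u0)
    (rv : (1 - C * T) * v2 = (A + W - (A * W + C) * T) * v1 - A * W * (1 - T) * v0)
    (h0 : u0 * v0 = p * S0) (h1 : u1 * v1 = p * A * S1) (hM : u1 * v0 = p * (Z + X * R))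
    (hM' : u0 * v1 = p * (Z + W * R))
    (hi : (1 - C * T) * R' = (1 - A * T) * S1 - (1 - T) * Z)
    (hii : (1 - C * T) * Z' = (A - C * T) * S1 - C * (1 - T) * R)
    (hiii : (1 - C * T) ^ 2 * A * S2 = (g ^ 2 + C * h ^ 2) * S1 - (1 - T) * 2 * C * h * Z
      - (1 - T) * 2 * C * g * R + A * C * (1 - T) ^ 2 * S0
      + (X + W) * (g * (1 - C * T) * R' - C * (1 - T) * h * R)) :
    u2 * v2 = p * A * A * S2 ∧ u2 * v1 = p * A * (Z' + X * R') ∧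
      u1 * v2 = p * A * (Z' + W * R') := by
  subst hg hh hW
  refine ⟨?_, ?_, ?_⟩
  · apply mul_left_cancel₀ (pow_ne_zero 2 hCT)
    linear_combination (1 - X * W * T) * v2 * ru +
      ((A + X - (A * X + X * W) * T) * u1 - A * X * (1 - T) * u0) * rv
      + (A + X - (A * X + X * W) * T) * (A + W - (A * W + X * W) * T) * h1
      - (A + X - (A * X + X * W) * T) * (A * W * (1 - T)) * hM
      - (A + W - (A * W + X * W) * T) * (A * X * (1 - T)) * hM'
      + A * X * (1 - T) * (A * W * (1 - T)) * h0 - p * A * hiii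
      - p * A * (X + W) * (A - X * W * T) * hi
  · apply mul_left_cancel₀ hCT
    linear_combination v1 * ru + (A + X - (A * X + X * W) * T) * h1 - A * X * (1 - T) * hM'
      - p * A * hii - p * A * X * hi
  · apply mul_left_cancel₀ hCT
    linear_combination u1 * rv + (A + W - (A * W + X * W) * T) * h1 - A * W * (1 - T) * hM
      - p * A * hii - p * A * W * hi

theorem trunc {F : Type*} [Field F] (f : ℕ → F) (m K : ℕ) (h : m ≤ K)
    (hf : ∀ j, m ≤ j → f j = 0) : ∑ j ∈ Finset.range K, f j = ∑ j ∈ Finset.range m, f j :=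
  Finset.eventually_constant_sum hf h

theorem main_aux {F : Type*} [Field F] (q A X C : F) (hq : q ≠ 0) (hA : A ≠ 0) (hX : X ≠ 0)
    (hq1 : ∀ k : ℕ, 1 - q ^ (k + 1) ≠ 0) (hC : ∀ k : ℕ, 1 - C * q ^ k ≠ 0) (K n : ℕ)
    (hK : n + 2 ≤ K) :
    (∑ j ∈ Finset.range K, ft q A X C n j) * (∑ j ∈ Finset.range K, ft q A (C / X) C n j) =
      A ^ n * ∑ j ∈ Finset.range K, St q A X C n j ∧
    (∑ j ∈ Finset.range K, ft q A X C (n + 1) j) *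
        (∑ j ∈ Finset.range K, ft q A (C / X) C (n + 1) j) =
      A ^ n * A * ∑ j ∈ Finset.range K, St q A X C (n + 1) j ∧
    (∑ j ∈ Finset.range K, ft q A X C (n + 1) j) * (∑ j ∈ Finset.range K, ft q A (C / X) C n j) =
      A ^ n * (∑ j ∈ Finset.range K, Zt q A X C n j + X * ∑ j ∈ Finset.range K, Rt q A X C n j) ∧
    (∑ j ∈ Finset.range K, ft q A X C n j) * (∑ j ∈ Finset.range K, ft q A (C / X) C (n + 1) j) =
      A ^ n * (∑ j ∈ Finset.range K, Zt q A X C n j +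
        (C / X) * ∑ j ∈ Finset.range K, Rt q A X C n j) := by
  induction n with
  | zero =>
    have f0 : ∀ X', ∑ j ∈ Finset.range K, ft q A X' C 0 j = 1 := fun X' => by
      rw [trunc _ 1 K (by omega) (fun j hj => by simp only [ft]; rw [qP_vanish q hq _ _ hj]; simp)]
      simp [ft, qPoch]
    have z1 := hq1 0
    have z2 := hC 0
    have z3 := hC 1
    simp only [zero_add, pow_one, pow_zero, mul_one] at z1 z2 z3
    have z3' : 1 - q * C ≠ 0 := by rwa [mul_comm]
    have f1 : ∀ X', ∑ j ∈ Finset.range K, ft q A X' C 1 j =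
        (A + X' - A * X' - C) / (1 - C) := fun X' => by
      rw [trunc _ 2 K (by omega) (fun j hj => by simp only [ft]; rw [qP_vanish q hq _ _ hj]; simp)]
      simp [ft, qPoch, Finset.sum_range_succ]
      field_simp
      ring
    have S0 : ∑ j ∈ Finset.range K, St q A X C 0 j = 1 := by
      rw [trunc _ 1 K (by omega) (fun j hj => by simp only [St]; rw [qP_vanish q hq _ _ hj]; simp)]
      simp [St, qPoch]
    have R0 : ∑ j ∈ Finset.range K, Rt q A X C 0 j = (1 - A) / (1 - C) := by
      rw [trunc _ 1 K (by omega) (fun j hj => by simp only [Rt]; rw [qP_vanish q hq _ _ hj]; simp)]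
      simp [Rt, qPoch]
    have Z0 : ∑ j ∈ Finset.range K, Zt q A X C 0 j = (A - C) / (1 - C) := by
      rw [trunc _ 1 K (by omega) (fun j hj => by simp only [Zt]; rw [qP_vanish q hq _ _ hj]; simp)]
      simp [Zt, qPoch]
      field_simp
    have S1 : ∑ j ∈ Finset.range K, St q A X C 1 j =
        1 - (1 - A) * (1 - C / A) * (1 - X) * (1 - C / X) / (1 - C) ^ 2 := by
      rw [trunc _ 2 K (by omega) (fun j hj => by simp only [St]; rw [qP_vanish q hq _ _ hj]; simp)]
      simp [St, qPoch, Finset.sum_range_succ, Finset.prod_range_succ]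
      field_simp
      ring
    simp only [zero_add, f0, f1, S0, R0, Z0, S1]
    refine ⟨by simp, ?_, ?_, ?_⟩
    · field_simp
      ring
    · field_simp
      ring
    · field_simp
      ring
  | succ n ih =>
    obtain ⟨h0, h1, hM, hM'⟩ := ih (by omega)
    have st := step_i q A X C hq hA hq1 hC n
    have hi : (1 - C * q ^ (n + 1)) * ∑ j ∈ Finset.range K, Rt q A X C (n + 1) j =
        (1 - A * q ^ (n + 1)) * ∑ j ∈ Finset.range K, St q A X C (n + 1) j -
        (1 - q ^ (n + 1)) * ∑ j ∈ Finset.range K, Zt q A X C n j := by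
      simp only [Finset.mul_sum, ← Finset.sum_sub_distrib]
      exact Finset.sum_congr rfl (fun j _ => (st j).1)
    have hii : (1 - C * q ^ (n + 1)) * ∑ j ∈ Finset.range K, Zt q A X C (n + 1) j =
        (A - C * q ^ (n + 1)) * ∑ j ∈ Finset.range K, St q A X C (n + 1) j -
        C * (1 - q ^ (n + 1)) * ∑ j ∈ Finset.range K, Rt q A X C n j := by
      simp only [Finset.mul_sum, ← Finset.sum_sub_distrib]
      exact Finset.sum_congr rfl (fun j _ => (st j).2)
    have hiii := step_iii q A X C hq hA hX hq1 hC n K (by omega) _ _ _ _ rfl rfl rfl rfl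
    have ru := f_rec q A X C hq hq1 hC n K (by omega)
    have rv := f_rec q A (C / X) C hq hq1 hC n K (by omega)
    obtain ⟨r1, r2, r3⟩ := alg_step A X C (C / X) (q ^ (n + 1)) (A ^ n) _ _ _ _ _ _ _ _ _ _ _ _ _
      _ _ (hC (n + 1)) (by field_simp) rfl rfl ru rv h0 h1 hM hM' hi hii hiii
    rw [pow_succ]
    exact ⟨h1, r1, r2, r3⟩

theorem main_gen {F : Type*} [Field F] (q A X C : F) (hq : q ≠ 0) (hA : A ≠ 0) (hX : X ≠ 0)
    (hq1 : ∀ k : ℕ, 1 - q ^ (k + 1) ≠ 0) (hC : ∀ k : ℕ, 1 - C * q ^ k ≠ 0) (n : ℕ) :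
    (∑ j ∈ Finset.range (n + 1), ft q A X C n j) *
      (∑ j ∈ Finset.range (n + 1), ft q A (C / X) C n j) =
      A ^ n * ∑ j ∈ Finset.range (n + 1), St q A X C n j := by
  have := (main_aux q A X C hq hA hX hq1 hC (n + 2) n le_rfl).1
  rwa [trunc _ (n + 1) (n + 2) (by omega)
      (fun j hj => by simp only [ft]; rw [qP_vanish q hq _ _ hj]; simp),
    trunc (fun j => ft q A (C / X) C n j) (n + 1) (n + 2) (by omega)
      (fun j hj => by simp only [ft]; rw [qP_vanish q hq _ _ hj]; simp),
    trunc _ (n + 1) (n + 2) (by omega)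
      (fun j hj => by simp only [St]; rw [qP_vanish q hq _ _ hj]; simp)] at this

theorem reidx {F : Type*} [Field F] (f : ℕ → F) (n s : ℕ) (hs : s ≤ n) :
    ∑ k ∈ Finset.Icc s n, f k = ∑ j ∈ Finset.range (n - s + 1), f (s + j) := by
  rw [← Finset.Ico_add_one_right_eq_Icc, Finset.sum_Ico_eq_sum_range]
  congr 2; omega

theorem full {F : Type*} [Field F] (q a x : F) (hq : q ≠ 0) (ha : a ≠ 0) (hx : x ≠ 0)
    (hq1 : ∀ k : ℕ, 1 - q ^ (k + 1) ≠ 0) (hqa : ∀ k : ℕ, 1 - q / a * q ^ k ≠ 0)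
    (n s : ℕ) (hs : s ≤ n) :
    (∑ k ∈ Finset.Icc s n,
        qPoch q ((q ^ n)⁻¹) k * qPoch q a k * qPoch q x k * q ^ k /
          (qPoch q q (k - s) * qPoch q q (k + s))) *
      (∑ k ∈ Finset.Icc s n,
        qPoch q ((q ^ n)⁻¹) k * qPoch q a k * qPoch q (q / x) k * q ^ k /
          (qPoch q q (k - s) * qPoch q q (k + s))) =
    qPoch q ((q ^ n)⁻¹) s * qPoch q a s * a ^ (n - s) *
      q ^ (((n : ℤ) + 1) * s - (s : ℤ) ^ 2) /
      (qPoch q (q ^ (n + 1)) s * qPoch q (q / a) s) *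
      ∑ k ∈ Finset.Icc s n,
        qPoch q ((q ^ n)⁻¹) k * qPoch q (q ^ (n + 1)) k * qPoch q a k * qPoch q (q / a) k *
          qPoch q x k * qPoch q (q / x) k * q ^ k /
          (qPoch q q (k - s) * qPoch q q (k + s) * qPoch q q (2 * k)) := by
  obtain ⟨N, rfl⟩ := Nat.exists_eq_add_of_le hs
  have hsq : q ^ s ≠ 0 := pow_ne_zero _ hq
  have hNq : q ^ N ≠ 0 := pow_ne_zero _ hq
  have hC : ∀ k : ℕ, 1 - q ^ (2 * s + 1) * q ^ k ≠ 0 := fun k => by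
    rw [← pow_add, show 2 * s + 1 + k = (2 * s + k) + 1 by ring]; exact hq1 _
  have hQ : ∀ m, qPoch q q m ≠ 0 := fun m => qP_ne _ _ _ (fun k => by
    rw [← pow_succ']; exact hq1 k)
  have key := main_gen q (a * q ^ s) (x * q ^ s) (q ^ (2 * s + 1)) hq (mul_ne_zero ha hsq)
    (mul_ne_zero hx hsq) hq1 hC N
  have c1 : q ^ (2 * s + 1) / (x * q ^ s) = q / x * q ^ s := by
    rw [pow_succ, two_mul, pow_add]; field_simp
  have c2 : q ^ (2 * s + 1) / (a * q ^ s) = q / a * q ^ s := by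
    rw [pow_succ, two_mul, pow_add]; field_simp
  have c3 : (q ^ (s + N))⁻¹ * q ^ s = (q ^ N)⁻¹ := by
    rw [pow_add]; field_simp
  have c4 : q ^ (s + N + 1) * q ^ s = q ^ (2 * s + 1) * q ^ N := by ring
  have c5 : q * q ^ (2 * s) = q ^ (2 * s + 1) := by ring
  have t1 : ∀ y, ∑ k ∈ Finset.Icc s (s + N),
        qPoch q ((q ^ (s + N))⁻¹) k * qPoch q a k * qPoch q y k * q ^ k /
          (qPoch q q (k - s) * qPoch q q (k + s)) =
      qPoch q ((q ^ (s + N))⁻¹) s * qPoch q a s * qPoch q y s * q ^ s / qPoch q q (2 * s) *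
      ∑ j ∈ Finset.range (N + 1), ft q (a * q ^ s) (y * q ^ s) (q ^ (2 * s + 1)) N j := by
    intro y
    rw [reidx _ _ _ hs, Nat.add_sub_cancel_left, Finset.mul_sum]
    apply Finset.sum_congr rfl
    intro j _
    rw [Nat.add_sub_cancel_left, show s + j + s = 2 * s + j by ring]
    simp only [ft, qP_add _ _ s j, qP_add _ _ (2 * s) j, c3, c5, pow_add q s j]
    have := hQ j
    have := hQ (2 * s)
    have : qPoch q (q ^ (2 * s + 1)) j ≠ 0 := qP_ne _ _ _ hC
    rw [div_mul_div_comm]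
    congr 1
    · ring
    · ring
  have t2 : ∑ k ∈ Finset.Icc s (s + N),
        qPoch q ((q ^ (s + N))⁻¹) k * qPoch q (q ^ (s + N + 1)) k * qPoch q a k *
          qPoch q (q / a) k * qPoch q x k * qPoch q (q / x) k * q ^ k /
          (qPoch q q (k - s) * qPoch q q (k + s) * qPoch q q (2 * k)) =
      qPoch q ((q ^ (s + N))⁻¹) s * qPoch q (q ^ (s + N + 1)) s * qPoch q a s *
          qPoch q (q / a) s * qPoch q x s * qPoch q (q / x) s * q ^ s / qPoch q q (2 * s) ^ 2 *
      ∑ j ∈ Finset.range (N + 1), St q (a * q ^ s) (x * q ^ s) (q ^ (2 * s + 1)) N j := by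
    rw [reidx _ _ _ hs, Nat.add_sub_cancel_left, Finset.mul_sum]
    apply Finset.sum_congr rfl
    intro j _
    rw [Nat.add_sub_cancel_left, show s + j + s = 2 * s + j by ring,
      show 2 * (s + j) = 2 * s + 2 * j by ring]
    simp only [St, qP_add _ _ s j, qP_add _ _ (2 * s) j, qP_add _ _ (2 * s) (2 * j), c1, c2, c3,
      c4, c5, pow_add q s j]
    have := hQ j
    have := hQ (2 * s)
    have : qPoch q (q ^ (2 * s + 1)) j ≠ 0 := qP_ne _ _ _ hC
    have : qPoch q (q ^ (2 * s + 1)) (2 * j) ≠ 0 := qP_ne _ _ _ hC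
    rw [div_mul_div_comm]
    congr 1
    · ring
    · ring
  rw [c1] at key
  have e1 : qPoch q (q ^ (s + N + 1)) s ≠ 0 := qP_ne _ _ _ (fun k => by
    rw [← pow_add, show s + N + 1 + k = (s + N + k) + 1 by ring]; exact hq1 _)
  have e2 : qPoch q (q / a) s ≠ 0 := qP_ne _ _ _ hqa
  have e3 := hQ (2 * s)
  have c6 : q ^ ((((s + N : ℕ) : ℤ) + 1) * s - (s : ℤ) ^ 2) = q ^ s * (q ^ s) ^ N := by
    rw [← pow_mul, ← pow_add, ← zpow_natCast]
    congr 1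
    push_cast; ring
  rw [t1, t2, t1, Nat.add_sub_cancel_left, c6]
  rw [mul_pow] at key
  generalize (∑ j ∈ Finset.range (N + 1), St q (a * q ^ s) (x * q ^ s) (q ^ (2 * s + 1)) N j) = S
    at *
  generalize (∑ j ∈ Finset.range (N + 1), ft q (a * q ^ s) (x * q ^ s) (q ^ (2 * s + 1)) N j) = f1
    at *
  generalize (∑ j ∈ Finset.range (N + 1), ft q (a * q ^ s) (q / x * q ^ s) (q ^ (2 * s + 1)) N j)
    = f2 at *
  generalize (q ^ s) ^ N = w at *
  have : ∀ c d : F, c * f1 * (d * f2) = c * d * (a ^ N * w * S) := fun c d => by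
    rw [← key]; ring
  rw [this]
  field_simp

theorem X_alg {p : MvPolynomial (Fin 3) ℚ} (h : p ≠ 0) :
    algebraMap (MvPolynomial (Fin 3) ℚ) F3 p ≠ 0 := by
  simpa using h

theorem q_Clausen_Orr_general_s (n s : ℕ) (hs : s ≤ n) :
    (∑ k ∈ Finset.Icc s n,
        qPoch q ((q ^ n)⁻¹) k * qPoch q a k * qPoch q x k * q ^ k /
          (qPoch q q (k - s) * qPoch q q (k + s))) *
      (∑ k ∈ Finset.Icc s n,
        qPoch q ((q ^ n)⁻¹) k * qPoch q a k * qPoch q (q / x) k * q ^ k /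
          (qPoch q q (k - s) * qPoch q q (k + s))) =
    qPoch q ((q ^ n)⁻¹) s * qPoch q a s * a ^ (n - s) *
      q ^ (((n : ℤ) + 1) * s - (s : ℤ) ^ 2) /
      (qPoch q (q ^ (n + 1)) s * qPoch q (q / a) s) *
      ∑ k ∈ Finset.Icc s n,
        qPoch q ((q ^ n)⁻¹) k * qPoch q (q ^ (n + 1)) k * qPoch q a k * qPoch q (q / a) k *
          qPoch q x k * qPoch q (q / x) k * q ^ k /
          (qPoch q q (k - s) * qPoch q q (k + s) * qPoch q q (2 * k)) := by

  have h0 : q ≠ 0 := X_alg (MvPolynomial.X_ne_zero 0)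
  have h1 : a ≠ 0 := X_alg (MvPolynomial.X_ne_zero 1)
  have h2 : x ≠ 0 := X_alg (MvPolynomial.X_ne_zero 2)
  refine full q a x h0 h1 h2 ?_ ?_ n s hs
  · intro k
    have : (1 - MvPolynomial.X 0 ^ (k + 1) : MvPolynomial (Fin 3) ℚ) ≠ 0 := by
      intro h
      have := congrArg (MvPolynomial.eval (fun _ => (0 : ℚ))) h
      simp at this
    have := X_alg this
    simp only [map_sub, map_one, map_pow] at this
    exact this
  · intro k hk
    have : (MvPolynomial.X 1 - MvPolynomial.X 0 ^ (k + 1) : MvPolynomial (Fin 3) ℚ) ≠ 0 := by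
      intro h
      have := congrArg (MvPolynomial.eval (fun i => if i = 1 then (1 : ℚ) else 0)) h
      simp at this
    have := X_alg this
    simp only [map_sub, map_pow] at this
    apply this
    change a - q ^ (k + 1) = 0
    field_simp at hk
    linear_combination hk
end
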